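/- arXiv:2603.16170 — 3 statements merged into one kernel-verified Lean document; each statement's English description precedes it below -/
import Mathlib

section
/- Let α > -1 and 2λ > α+2. Then as r → 1⁻, ‖(1-rz)^{-λ}‖²_α = (Γ(α+2)Γ(2λ-α-2)/Γ(λ)²) · (1+o(1))/(1-r²)^{2λ-α-2}, where ‖·‖_α is the weighted Bergman norm. -/
open MeasureTheory Complex Real Filter

noncomputable def bergmanNormSq (α : ℝ) (φ : ℂ → ℂ) : ℝ :=
  (α + 1) / π * ∫ z in Metric.ball (0 : ℂ) 1, ‖φ z‖ ^ 2 * (1 - ‖z‖ ^ 2) ^ α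

lemma hs_congr {E : Type*} [AddCommMonoid E] [TopologicalSpace E] {f g : ℕ → E} {a : E}
    (h : ∀ n, f n = g n) (hf : HasSum f a) : HasSum g a := by
  rwa [← funext h]

noncomputable def binA (s : ℝ) (n : ℕ) : ℝ := (∏ j ∈ Finset.range n, (s + j)) / n.factorial

lemma binA_pos {s : ℝ} (hs : 0 < s) (n : ℕ) : 0 < binA s n := by
  unfold binA
  apply div_pos
  · exact Finset.prod_pos fun j _ => by positivity
  · exact_mod_cast n.factorial_pos

lemma binA_eq_choose (s : ℝ) (n : ℕ) : Ring.choose ((s : ℂ) + n - 1) n = (binA s n : ℂ) := by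
  rw [← Ring.multichoose_eq]
  have h := Ring.factorial_nsmul_multichoose_eq_ascPochhammer (s : ℂ) n
  have hp : ∀ m : ℕ, (ascPochhammer ℂ m).eval (s : ℂ) = ∏ j ∈ Finset.range m, ((s : ℂ) + j) := by
    intro m
    induction m with
    | zero => simp
    | succ m ih => rw [ascPochhammer_succ_eval, Finset.prod_range_succ, ih]
  rw [Polynomial.ascPochhammer_smeval_eq_eval, hp, nsmul_eq_mul] at h
  have : (n.factorial : ℂ) ≠ 0 := by exact_mod_cast n.factorial_ne_zero
  unfold binA
  push_cast
  rw [← h]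
  field_simp

lemma hasSum_binA (s : ℝ) {w : ℂ} (hw : ‖w‖ < 1) :
    HasSum (fun n : ℕ => (binA s n : ℂ) * w ^ n) ((1 - w) ^ (-(s : ℂ))) := by
  have h := (one_div_one_sub_cpow_hasFPowerSeriesOnBall_zero (s : ℂ)).hasSum (y := w)
    (by simpa [← ENNReal.ofReal_one, Metric.eball_ofReal] using hw)
  simp only [zero_add, one_div, ← cpow_neg] at h
  refine hs_congr (fun n => ?_) h
  simp [FormalMultilinearSeries.ofScalars, binA_eq_choose]

lemma hasSum_binA_real (s : ℝ) {x : ℝ} (hx0 : 0 ≤ x) (hx : x < 1) :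
    HasSum (fun n : ℕ => binA s n * x ^ n) ((1 - x) ^ (-s)) := by
  have h := hasSum_binA s (w := (x : ℂ)) (by simpa [abs_of_nonneg hx0] using hx)
  rw [← hasSum_ofReal]
  convert h using 1
  · push_cast; rfl
  · rw [Complex.ofReal_cpow (by linarith)]; push_cast; rfl

lemma binA_succ_eq {s : ℝ} (hs : 0 < s) {n : ℕ} (hn : 0 < n) :
    binA s (n + 1) = (n : ℝ) ^ s / ((n + 1) * Real.GammaSeq s n) := by
  have h1 : (0 : ℝ) < ∏ j ∈ Finset.range (n + 1), (s + j) :=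
    Finset.prod_pos fun j _ => by positivity
  have h2 : (0 : ℝ) < n.factorial := by exact_mod_cast n.factorial_pos
  have h3 : (0 : ℝ) < (n : ℝ) ^ s := by positivity
  unfold binA Real.GammaSeq
  rw [Nat.factorial_succ]
  push_cast
  field_simp

lemma ratio_tendsto {a s l : ℝ} (ha : 0 < a) (hs : 0 < s) (hl : 0 < l) (h : a + s = 2 * l) :
    Tendsto (fun n => binA l n ^ 2 / binA a n / binA s n) atTop
      (nhds (Real.Gamma a * Real.Gamma s / Real.Gamma l ^ 2)) := by
  rw [← tendsto_add_atTop_iff_nat 1]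
  have := ((Real.GammaSeq_tendsto_Gamma a).mul (Real.GammaSeq_tendsto_Gamma s)).div
    ((Real.GammaSeq_tendsto_Gamma l).pow 2) (pow_ne_zero 2 (Real.Gamma_pos_of_pos hl).ne')
  refine this.congr' ?_
  filter_upwards [eventually_gt_atTop 0] with n hn
  have key : ∀ t : ℝ, 0 < t → 0 < Real.GammaSeq t n := by
    intro t ht
    unfold Real.GammaSeq
    have h1 : (0 : ℝ) < ∏ j ∈ Finset.range (n + 1), (t + j) :=
      Finset.prod_pos fun j _ => by positivity
    positivity
  have k1 := key a ha
  have k2 := key s hs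
  have k3 := key l hl
  have hn' : (0:ℝ) < n := by exact_mod_cast hn
  rw [binA_succ_eq ha hn, binA_succ_eq hs hn, binA_succ_eq hl hn]
  have e : ((n : ℝ) ^ l) ^ 2 = (n : ℝ) ^ a * (n : ℝ) ^ s := by
    rw [← Real.rpow_add hn', h, ← Real.rpow_natCast, ← Real.rpow_mul hn'.le]
    congr 1; push_cast; ring
  have p1 : (0 : ℝ) < (n : ℝ) ^ a := by positivity
  have p2 : (0 : ℝ) < (n : ℝ) ^ s := by positivity
  simp only [Pi.div_apply]
  rw [div_pow, mul_pow, e]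
  field_simp

lemma summable_of_ratio {a b : ℕ → ℝ} {L : ℝ} (hb : ∀ n, 0 < b n)
    (hL : Tendsto (fun n => a n / b n) atTop (nhds L)) {x : ℝ} (hx0 : 0 ≤ x)
    (hs : Summable fun n => b n * x ^ n) : Summable fun n => a n * x ^ n := by
  obtain ⟨C, hC⟩ := (hL.abs).bddAbove_range
  refine Summable.of_norm_bounded (hs.mul_left C) fun n => ?_
  have h1 : |a n / b n| ≤ C := hC ⟨n, rfl⟩
  rw [abs_div, abs_of_pos (hb n), div_le_iff₀ (hb n)] at h1
  rw [norm_mul, norm_pow, Real.norm_eq_abs, Real.norm_eq_abs, abs_of_nonneg hx0, ← mul_assoc]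
  gcongr

lemma abelian {a : ℕ → ℝ} {s L : ℝ} (hs : 0 < s)
    (hL : Tendsto (fun n => a n / binA s n) atTop (nhds L)) :
    Tendsto (fun x : ℝ => (1 - x) ^ s * ∑' n, a n * x ^ n) (nhdsWithin 1 (Set.Ioo 0 1))
      (nhds L) := by
  set b := binA s with hbdef
  have hb : ∀ n, 0 < b n := binA_pos hs
  rw [Metric.tendsto_nhds]
  intro ε hε
  obtain ⟨N, hN⟩ := (Metric.tendsto_atTop.1 hL) (ε / 2) (by positivity)
  set K := ∑ n ∈ Finset.range N, |a n - L * b n| with hK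
  have t0 : Tendsto (fun x : ℝ => (1 - x) ^ s * K) (nhdsWithin 1 (Set.Ioo 0 1)) (nhds 0) := by
    have : ContinuousAt (fun x : ℝ => (1 - x) ^ s * K) 1 := by
      apply ContinuousAt.mul _ continuousAt_const
      exact ContinuousAt.rpow_const (by fun_prop) (Or.inr hs.le)
    have h2 := this.tendsto
    simp only [sub_self, Real.zero_rpow hs.ne', zero_mul] at h2
    exact h2.mono_left nhdsWithin_le_nhds
  have t1 := t0.eventually (gt_mem_nhds (half_pos hε))
  filter_upwards [t1, self_mem_nhdsWithin] with x hx1 hx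
  obtain ⟨hx0, hxlt⟩ := hx
  have hB := hasSum_binA_real s hx0.le hxlt
  have hA := summable_of_ratio hb hL hx0.le hB.summable
  have hpos : 0 < (1 - x) ^ s := Real.rpow_pos_of_pos (by linarith) _
  have hinv : (1 - x) ^ s * (1 - x) ^ (-s) = 1 := by
    rw [← Real.rpow_add (by linarith)]; simp
  have hD : HasSum (fun n => (a n - L * b n) * x ^ n)
      ((∑' n, a n * x ^ n) - L * (1 - x) ^ (-s)) := by
    refine hs_congr (fun n => ?_) (hA.hasSum.sub (hB.mul_left L))
    ring
  have hbd : HasSum (fun n => (if n ∈ Finset.range N then |a n - L * b n| else 0)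
      + ε / 2 * (b n * x ^ n)) (K + ε / 2 * (1 - x) ^ (-s)) := by
    apply HasSum.add _ (hB.mul_left _)
    have := hasSum_sum_of_ne_finset_zero (L := SummationFilter.unconditional ℕ)
      (s := Finset.range N)
      (f := fun n => if n ∈ Finset.range N then |a n - L * b n| else 0)
      (by intro n hn; simp only [if_neg hn])
    have hKe : K = ∑ n ∈ Finset.range N, if n ∈ Finset.range N then |a n - L * b n| else 0 :=
      Finset.sum_congr rfl fun n hn => by rw [if_pos hn]
    rw [hKe]
    exact this
  have hle : |(∑' n, a n * x ^ n) - L * (1 - x) ^ (-s)| ≤ K + ε / 2 * (1 - x) ^ (-s) := by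
    rw [← hD.tsum_eq, ← Real.norm_eq_abs]
    refine tsum_of_norm_bounded hbd fun n => ?_
    rw [Real.norm_eq_abs, abs_mul, abs_of_nonneg (pow_nonneg hx0.le n)]
    have hxn : x ^ n ≤ 1 := pow_le_one₀ hx0.le hxlt.le
    have hxn0 : 0 ≤ x ^ n := pow_nonneg hx0.le n
    have := hb n
    by_cases hn : n ∈ Finset.range N
    · rw [if_pos hn]
      have : 0 ≤ ε / 2 * (b n * x ^ n) := by positivity
      nlinarith [abs_nonneg (a n - L * b n)]
    · rw [if_neg hn, zero_add, ← mul_assoc]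
      gcongr
      have h3 := hN n (by simpa using hn)
      rw [Real.dist_eq, div_sub' (hb n).ne', abs_div, abs_of_pos (hb n), div_lt_iff₀ (hb n)] at h3
      rw [mul_comm L]; exact h3.le
  rw [Real.dist_eq]
  have : (1 - x) ^ s * ∑' n, a n * x ^ n - L
      = (1 - x) ^ s * ((∑' n, a n * x ^ n) - L * (1 - x) ^ (-s)) := by
    linear_combination (-L) * (-hinv)
  rw [this, abs_mul, abs_of_pos hpos]
  calc _ ≤ (1 - x) ^ s * (K + ε / 2 * (1 - x) ^ (-s)) := by gcongr
    _ = (1 - x) ^ s * K + ε / 2 := by linear_combination (ε / 2) * hinv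
    _ < ε := by linarith


lemma orth (m n : ℕ) : ∫ θ in Set.Ioo (-π) π,
    (starRingEnd ℂ) (cexp (θ * I) ^ m) * cexp (θ * I) ^ n = if m = n then (2 * π : ℂ) else 0 := by
  have e : ∀ θ : ℝ, (starRingEnd ℂ) (cexp (θ * I) ^ m) * cexp (θ * I) ^ n
      = cexp ((((n : ℂ) - m) * I) * θ) := by
    intro θ
    rw [map_pow, ← Complex.exp_conj, map_mul, Complex.conj_ofReal, Complex.conj_I,
      ← Complex.exp_nat_mul, ← Complex.exp_nat_mul, ← Complex.exp_add]
    congr 1; ring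
  simp only [e]
  rw [← integral_Ioc_eq_integral_Ioo, ← intervalIntegral.integral_of_le (by linarith [Real.pi_pos])]
  split_ifs with h
  · subst h; simp; ring
  · have hne : ((n : ℂ) - m) ≠ 0 := by
      rw [sub_ne_zero]; exact_mod_cast Ne.symm h
    rw [integral_exp_mul_complex (mul_ne_zero hne I_ne_zero)]
    have : cexp ((((n : ℂ) - m) * I) * (π : ℝ)) = cexp ((((n : ℂ) - m) * I) * ((-π : ℝ) : ℂ)) := by
      rw [Complex.exp_eq_exp_iff_exists_int]
      exact ⟨(n : ℤ) - m, by push_cast; ring⟩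
    rw [this, sub_self, zero_div]

lemma parseval (c : ℕ → ℝ) (hc : Summable fun n => |c n|) (g : ℝ → ℂ)
    (hg : ∀ θ : ℝ, HasSum (fun n => (c n : ℂ) * cexp (θ * I) ^ n) (g θ)) :
    HasSum (fun n => 2 * π * c n ^ 2) (∫ θ in Set.Ioo (-π) π, ‖g θ‖ ^ 2) := by
  have hn : ∀ (θ : ℝ) (n : ℕ), ‖(c n : ℂ) * cexp (θ * I) ^ n‖ = |c n| := by
    intro θ n
    simp [Complex.norm_exp_ofReal_mul_I]
  have hgc : Continuous g := by
    have : g = fun θ : ℝ => ∑' n, (c n : ℂ) * cexp (θ * I) ^ n := by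
      ext θ; exact (hg θ).tsum_eq.symm
    rw [this]
    exact continuous_tsum (fun n => by fun_prop) hc fun n θ => (hn θ n).le
  have hcint : ∀ F : ℝ → ℂ, Continuous F → IntegrableOn F (Set.Ioo (-π) π) := fun F hF =>
    (hF.integrableOn_Icc (a := -π) (b := π)).mono_set Set.Ioo_subset_Icc_self
  set C := ∑' n, |c n| with hC
  have hgb : ∀ θ, ‖g θ‖ ≤ C := fun θ => by
    rw [← (hg θ).tsum_eq]
    exact tsum_of_norm_bounded hc.hasSum fun n => (hn θ n).le
  have hvol : ∀ K : ℝ, ∫ _θ in Set.Ioo (-π) π, K = 2 * π * K := by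
    intro K
    simp [Real.volume_real_Ioo_of_le (show -π ≤ π by linarith [Real.pi_pos])]
    ring_nf; simp
  have inner : ∀ n, ∫ θ in Set.Ioo (-π) π, (starRingEnd ℂ) (g θ) * cexp (θ * I) ^ n
      = 2 * π * c n := by
    intro n
    have h1 := hasSum_integral_of_summable_integral_norm
      (μ := volume.restrict (Set.Ioo (-π) π))
      (F := fun (m : ℕ) (θ : ℝ) =>
        (starRingEnd ℂ) ((c m : ℂ) * cexp (θ * I) ^ m) * cexp (θ * I) ^ n)
      (fun m => hcint _ (by fun_prop)) (by
        refine (hc.mul_left (2 * π)).congr fun m => ?_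
        rw [← hvol]
        congr 1; ext θ
        rw [norm_mul, RCLike.norm_conj, hn, norm_pow, Complex.norm_exp_ofReal_mul_I]; simp)
    have h2 : ∀ θ : ℝ, ∑' m, (starRingEnd ℂ) ((c m : ℂ) * cexp (θ * I) ^ m) * cexp (θ * I) ^ n
        = (starRingEnd ℂ) (g θ) * cexp (θ * I) ^ n := fun θ =>
      ((Complex.hasSum_conj'.mpr (by simpa using hg θ)).mul_right _).tsum_eq
    simp only [h2] at h1
    have h3 : ∀ m, ∫ θ in Set.Ioo (-π) π,
        (starRingEnd ℂ) ((c m : ℂ) * cexp (θ * I) ^ m) * cexp (θ * I) ^ n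
        = if m = n then (2 * π * c n : ℂ) else 0 := by
      intro m
      simp only [map_mul, Complex.conj_ofReal, mul_assoc]
      rw [integral_const_mul, orth]
      split_ifs with h
      · rw [h]; ring
      · simp
    simp only [h3] at h1
    exact h1.unique (hasSum_ite_eq n _)
  have h1 := hasSum_integral_of_summable_integral_norm
      (μ := volume.restrict (Set.Ioo (-π) π))
      (F := fun (n : ℕ) (θ : ℝ) => (starRingEnd ℂ) (g θ) * ((c n : ℂ) * cexp (θ * I) ^ n))
      (fun m => hcint _ (by fun_prop)) (by
        refine Summable.of_nonneg_of_le (fun m => by positivity) (fun m => ?_)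
          ((hc.mul_left C).mul_left (2 * π))
        rw [← hvol]
        refine integral_mono (hcint _ (by fun_prop)).norm (integrable_const _) fun θ => ?_
        simp only
        rw [norm_mul, RCLike.norm_conj, hn]
        gcongr
        exact hgb θ)
  have h2 : ∀ θ : ℝ, ∑' n, (starRingEnd ℂ) (g θ) * ((c n : ℂ) * cexp (θ * I) ^ n)
      = ((‖g θ‖ ^ 2 : ℝ) : ℂ) := fun θ => by
    rw [((hg θ).mul_left _).tsum_eq, Complex.conj_mul']; push_cast; rfl
  simp only [h2] at h1
  rw [integral_complex_ofReal] at h1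
  rw [← hasSum_ofReal]
  refine hs_congr (fun n => ?_) h1
  simp only [mul_left_comm _ (c n : ℂ)]
  rw [integral_const_mul, inner]
  push_cast; ring

lemma beta_real {α : ℝ} (hα : -1 < α) (n : ℕ) :
    IntegrableOn (fun u : ℝ => u ^ n * (1 - u) ^ α) (Set.Ioo 0 1) ∧
    ∫ u in Set.Ioo (0 : ℝ) 1, u ^ n * (1 - u) ^ α
      = Real.Gamma (n + 1) * Real.Gamma (α + 1) / Real.Gamma (n + 1 + (α + 1)) := by
  have hu : 0 < ((n : ℂ) + 1).re := by simp; positivity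
  have hv : 0 < ((α : ℂ) + 1).re := by simp; linarith
  have h1 := Complex.betaIntegral_convergent hu hv
  have h2 := Complex.betaIntegral_eq_Gamma_mul_div _ _ hu hv
  rw [Complex.betaIntegral, intervalIntegral.integral_of_le zero_le_one,
    integral_Ioc_eq_integral_Ioo] at h2
  rw [intervalIntegrable_iff_integrableOn_Ioo_of_le zero_le_one] at h1
  have e : ∀ x ∈ Set.Ioo (0 : ℝ) 1, (x : ℂ) ^ ((n : ℂ) + 1 - 1) * (1 - (x : ℂ)) ^ ((α : ℂ) + 1 - 1)
      = ((x ^ n * (1 - x) ^ α : ℝ) : ℂ) := by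
    intro x hx
    rw [add_sub_cancel_right, add_sub_cancel_right]
    push_cast
    rw [Complex.ofReal_cpow (by linarith [hx.2]), Complex.cpow_natCast]
    push_cast; rfl
  rw [setIntegral_congr_fun measurableSet_Ioo e, integral_complex_ofReal] at h2
  rw [integrableOn_congr_fun e measurableSet_Ioo] at h1
  constructor
  · exact h1.re.congr (Eventually.of_forall fun x => Complex.ofReal_re _)
  · have e1 : ((n : ℂ) + 1) = ((n + 1 : ℝ) : ℂ) := by push_cast; rfl
    have e2 : ((α : ℂ) + 1) = ((α + 1 : ℝ) : ℂ) := by push_cast; rfl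
    rw [e1, e2, ← Complex.ofReal_add, Complex.Gamma_ofReal, Complex.Gamma_ofReal,
      Complex.Gamma_ofReal] at h2
    exact_mod_cast h2

lemma beta_sq {α : ℝ} (hα : -1 < α) (n : ℕ) :
    IntegrableOn (fun ρ : ℝ => ρ * (1 - ρ ^ 2) ^ α * ρ ^ (2 * n)) (Set.Ioo 0 1) ∧
    ∫ ρ in Set.Ioo (0 : ℝ) 1, ρ * (1 - ρ ^ 2) ^ α * ρ ^ (2 * n)
      = (Real.Gamma (n + 1) * Real.Gamma (α + 1) / Real.Gamma (n + 1 + (α + 1))) / 2 := by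
  obtain ⟨h1, h2⟩ := beta_real hα n
  have him : (fun x : ℝ => x ^ 2) '' Set.Ioo 0 1 = Set.Ioo 0 1 := by
    ext y
    constructor
    · rintro ⟨x, ⟨hx0, hx1⟩, rfl⟩
      exact ⟨by positivity, by simp only; nlinarith⟩
    · rintro ⟨hy0, hy1⟩
      refine ⟨√y, ⟨Real.sqrt_pos.2 hy0, ?_⟩, Real.sq_sqrt hy0.le⟩
      rw [Real.sqrt_lt' one_pos]; simpa using hy1
  have hd : ∀ x ∈ Set.Ioo (0 : ℝ) 1,
      HasDerivWithinAt (fun x : ℝ => x ^ 2) (2 * x) (Set.Ioo 0 1) x := by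
    intro x _
    simpa using (hasDerivAt_pow 2 x).hasDerivWithinAt
  have hinj : Set.InjOn (fun x : ℝ => x ^ 2) (Set.Ioo 0 1) := by
    intro x hx y hy hxy
    exact (pow_left_inj₀ hx.1.le hy.1.le two_ne_zero).1 hxy
  have e : ∀ x ∈ Set.Ioo (0 : ℝ) 1, |2 * x| • ((x ^ 2) ^ n * (1 - x ^ 2) ^ α)
      = 2 * (x * (1 - x ^ 2) ^ α * x ^ (2 * n)) := by
    intro x hx
    rw [abs_of_pos (by linarith [hx.1]), smul_eq_mul, ← pow_mul]; ring
  rw [← him, integrableOn_image_iff_integrableOn_abs_deriv_smul measurableSet_Ioo hd hinj,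
    integrableOn_congr_fun e measurableSet_Ioo] at h1
  rw [← him, integral_image_eq_integral_abs_deriv_smul measurableSet_Ioo hd hinj,
    setIntegral_congr_fun measurableSet_Ioo e, integral_const_mul] at h2
  constructor
  · have := h1.const_mul (1 / 2)
    refine this.congr (Eventually.of_forall fun x => ?_)
    simp only; ring
  · linarith

lemma binA_Gamma {a : ℝ} (ha : 0 < a) (n : ℕ) :
    Real.Gamma (n + a) = Real.Gamma a * (binA a n * n.factorial) := by
  have h2 : (n.factorial : ℝ) ≠ 0 := by exact_mod_cast n.factorial_ne_zero
  unfold binA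
  rw [div_mul_cancel₀ _ h2]
  clear h2
  induction n with
  | zero => simp
  | succ n ih =>
    rw [Finset.prod_range_succ, ← mul_assoc, ← ih]
    push_cast
    rw [show (n : ℝ) + 1 + a = (n + a) + 1 by ring, Real.Gamma_add_one (by positivity)]
    ring

lemma beta_binA {α : ℝ} (hα : -1 < α) (n : ℕ) :
    (α + 1) / π * (2 * π *
      ((Real.Gamma (n + 1) * Real.Gamma (α + 1) / Real.Gamma (n + 1 + (α + 1))) / 2))
      = 1 / binA (α + 2) n := by
  have h2 : (n.factorial : ℝ) ≠ 0 := by exact_mod_cast n.factorial_ne_zero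
  have h3 := (binA_pos (show 0 < α + 2 by linarith) n).ne'
  have h4 := (Real.Gamma_pos_of_pos (show 0 < α + 2 by linarith)).ne'
  have h5 : Real.Gamma (α + 2) = (α + 1) * Real.Gamma (α + 1) := by
    rw [← Real.Gamma_add_one (by linarith)]; congr 1; ring
  rw [show (n : ℝ) + 1 + (α + 1) = n + (α + 2) by ring,
    binA_Gamma (a := α + 2) (by linarith), Real.Gamma_nat_eq_factorial]
  have hpi := Real.pi_pos.ne'
  rw [h5] at h4 ⊢
  have h6 := left_ne_zero_of_mul h4
  have h7 := right_ne_zero_of_mul h4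
  field_simp

lemma bergman_polar (α : ℝ) (hα : -1 < α) (φ : ℂ → ℂ) (hφ : ContinuousOn φ (Metric.ball 0 1))
    {C : ℝ} (hC : ∀ z ∈ Metric.ball (0 : ℂ) 1, ‖φ z‖ ≤ C) :
    ∫ z in Metric.ball (0 : ℂ) 1, ‖φ z‖ ^ 2 * (1 - ‖z‖ ^ 2) ^ α
      = ∫ ρ in Set.Ioo (0 : ℝ) 1, ρ * (1 - ρ ^ 2) ^ α *
        ∫ θ in Set.Ioo (-π) π, ‖φ (ρ * cexp (θ * I))‖ ^ 2 := by
  rw [← integral_indicator measurableSet_ball, ← Complex.integral_comp_polarCoord_symm,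
    polarCoord_target]
  have hsub : Set.Ioo (0 : ℝ) 1 ×ˢ Set.Ioo (-π) π ⊆ Set.Ioi (0 : ℝ) ×ˢ Set.Ioo (-π) π :=
    Set.prod_mono Set.Ioo_subset_Ioi_self le_rfl
  have hz : ∀ p : ℝ × ℝ, Complex.polarCoord.symm p = p.1 * cexp (p.2 * I) := by
    intro p
    rw [Complex.polarCoord_symm_apply, Complex.exp_mul_I]; push_cast; rfl
  have hnz : ∀ p : ℝ × ℝ, 0 < p.1 → ‖(p.1 * cexp (p.2 * I) : ℂ)‖ = p.1 := by
    intro p hp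
    rw [norm_mul, Complex.norm_exp_ofReal_mul_I]; simp [abs_of_pos hp]
  rw [setIntegral_eq_of_subset_of_forall_sdiff_eq_zero
    (measurableSet_Ioi.prod measurableSet_Ioo) hsub]
  swap
  · rintro p ⟨⟨hp1, hp2⟩, hp3⟩
    rw [Set.indicator_of_notMem, smul_zero]
    rw [hz, mem_ball_zero_iff, hnz p hp1]
    intro h
    exact hp3 ⟨⟨hp1, h⟩, hp2⟩
  have hms : MeasurableSet (Set.Ioo (0 : ℝ) 1 ×ˢ Set.Ioo (-π) π) :=
    measurableSet_Ioo.prod measurableSet_Ioo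
  have hmem : ∀ p ∈ Set.Ioo (0 : ℝ) 1 ×ˢ Set.Ioo (-π) π,
      (p.1 * cexp (p.2 * I) : ℂ) ∈ Metric.ball (0 : ℂ) 1 := by
    intro p hp
    rw [mem_ball_zero_iff, hnz p hp.1.1]; exact hp.1.2
  rw [setIntegral_congr_fun (g := fun p : ℝ × ℝ =>
    (p.1 * (1 - p.1 ^ 2) ^ α) * ‖φ (p.1 * cexp (p.2 * I))‖ ^ 2) hms]
  swap
  · intro p hp
    simp only
    rw [hz, Set.indicator_of_mem (hmem p hp), hnz p hp.1.1, smul_eq_mul]; ring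
  rw [Measure.volume_eq_prod, setIntegral_prod]
  · simp only [integral_const_mul]
  · have hw := (beta_sq hα 0).1
    simp only [mul_zero, pow_zero, mul_one] at hw
    have h1 : Integrable (fun _ : ℝ => (1 : ℝ)) (volume.restrict (Set.Ioo (-π) π)) :=
      integrable_const _
    have h2 := Integrable.mul_prod hw h1
    rw [Measure.prod_restrict] at h2
    simp only [mul_one] at h2
    refine Integrable.mul_bdd (c := C ^ 2) h2 ?_ ?_
    · refine ContinuousOn.aestronglyMeasurable ?_ hms
      refine (ContinuousOn.norm (hφ.comp ?_ hmem)).pow 2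
      fun_prop
    · rw [ae_restrict_iff' hms]
      refine Eventually.of_forall fun p hp => ?_
      rw [norm_pow, norm_norm]
      gcongr
      exact hC _ (hmem p hp)

lemma bergman_eq {α lam : ℝ} (hα : -1 < α) (h : α + 2 < 2 * lam) {r : ℝ}
    (hr : r ∈ Set.Ioo (0 : ℝ) 1) :
    bergmanNormSq α (fun z : ℂ => (1 - (r : ℂ) * z) ^ (-(lam : ℂ)))
      = ∑' n, binA lam n ^ 2 / binA (α + 2) n * (r ^ 2) ^ n := by
  obtain ⟨hr0, hr1⟩ := hr
  have hl : 0 < lam := by linarith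
  have hpos : ∀ n, 0 < binA lam n := binA_pos hl
  have hS := hasSum_binA_real lam hr0.le hr1
  have hrz : ∀ z ∈ Metric.ball (0 : ℂ) 1, ‖(r : ℂ) * z‖ < 1 := by
    intro z hz
    rw [mem_ball_zero_iff] at hz
    rw [norm_mul, Complex.norm_real, Real.norm_eq_abs, abs_of_pos hr0]
    nlinarith [norm_nonneg z]
  unfold bergmanNormSq
  rw [bergman_polar α hα _ (C := (1 - r) ^ (-lam))]
  rotate_left
  · refine ContinuousOn.cpow_const (by fun_prop) fun z hz => ?_
    have := Complex.mem_slitPlane_of_norm_lt_one (z := -((r : ℂ) * z))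
      (by rw [norm_neg]; exact hrz z hz)
    simpa [sub_eq_add_neg] using this
  · intro z hz
    rw [← (hasSum_binA lam (hrz z hz)).tsum_eq]
    refine tsum_of_norm_bounded hS fun n => ?_
    rw [mem_ball_zero_iff] at hz
    rw [norm_mul, Complex.norm_real, Real.norm_eq_abs, abs_of_pos (hpos n), norm_pow, norm_mul,
      Complex.norm_real, Real.norm_eq_abs, abs_of_pos hr0]
    have := (hpos n).le
    gcongr
    nlinarith [norm_nonneg z]
  have inner : ∀ ρ ∈ Set.Ioo (0 : ℝ) 1, ρ * (1 - ρ ^ 2) ^ α *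
      ∫ θ in Set.Ioo (-π) π, ‖(1 - (r : ℂ) * (ρ * cexp (θ * I))) ^ (-(lam : ℂ))‖ ^ 2
      = ∑' n, (2 * π * (binA lam n ^ 2 * (r ^ 2) ^ n)) *
          (ρ * (1 - ρ ^ 2) ^ α * ρ ^ (2 * n)) := by
    intro ρ hρ
    have hp := parseval (fun n => binA lam n * (r * ρ) ^ n) (by
      have h1 : r * ρ < 1 := by nlinarith [hρ.1, hρ.2]
      have h0 : 0 ≤ r * ρ := mul_nonneg hr0.le hρ.1.le
      refine (hasSum_binA_real lam h0 h1).summable.congr fun n => ?_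
      rw [abs_of_nonneg]
      have := hpos n
      positivity) (fun θ => (1 - (r : ℂ) * (ρ * cexp (θ * I))) ^ (-(lam : ℂ))) (by
      intro θ
      refine hs_congr (fun n => ?_) (hasSum_binA lam (hrz (ρ * cexp (θ * I)) ?_))
      · push_cast; rw [mul_pow, mul_pow, mul_pow]; ring
      · rw [mem_ball_zero_iff, norm_mul, Complex.norm_exp_ofReal_mul_I]
        simp [abs_of_pos hρ.1, hρ.2])
    rw [← (hp.mul_left (ρ * (1 - ρ ^ 2) ^ α)).tsum_eq]
    congr 1; ext n
    rw [mul_pow, mul_pow, mul_pow, ← pow_mul, ← pow_mul, ← pow_mul, mul_comm n 2]; ring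
  rw [setIntegral_congr_fun measurableSet_Ioo inner]
  have hratio := ratio_tendsto (a := α + 2) (s := 2 * lam - α - 2) (l := lam) (by linarith)
    (by linarith) hl (by ring)
  have hs0 : 0 < 2 * lam - α - 2 := by linarith
  have hsum := summable_of_ratio (binA_pos hs0) hratio (sq_nonneg r)
    (hasSum_binA_real _ (sq_nonneg r) (by nlinarith)).summable
  have hcoef : ∀ n, (α + 1) / π * ∫ ρ in Set.Ioo (0 : ℝ) 1,
      (2 * π * (binA lam n ^ 2 * (r ^ 2) ^ n)) * (ρ * (1 - ρ ^ 2) ^ α * ρ ^ (2 * n))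
      = binA lam n ^ 2 / binA (α + 2) n * (r ^ 2) ^ n := by
    intro n
    rw [integral_const_mul, (beta_sq hα n).2]
    have := beta_binA hα n
    linear_combination (binA lam n ^ 2 * (r ^ 2) ^ n) * this
  have hc : (α + 1) / π ≠ 0 := div_ne_zero (by linarith) Real.pi_pos.ne'
  have key := hasSum_integral_of_summable_integral_norm
    (μ := volume.restrict (Set.Ioo (0 : ℝ) 1))
    (F := fun (n : ℕ) (ρ : ℝ) =>
      (2 * π * (binA lam n ^ 2 * (r ^ 2) ^ n)) * (ρ * (1 - ρ ^ 2) ^ α * ρ ^ (2 * n)))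
    (fun n => (beta_sq hα n).1.const_mul _) (by
      rw [← summable_mul_left_iff hc]
      refine hsum.congr fun n => ?_
      rw [← hcoef]
      congr 1
      refine setIntegral_congr_fun measurableSet_Ioo fun ρ hρ => ?_
      rw [Real.norm_of_nonneg]
      have h1 : 0 < ρ := hρ.1
      have h2 : 0 ≤ (1 - ρ ^ 2) ^ α := Real.rpow_nonneg (by nlinarith [hρ.2]) _
      positivity)
  rw [← (key.mul_left ((α + 1) / π)).tsum_eq]
  exact tsum_congr hcoef

theorem bergman_norm_asymptotic (α lam : ℝ) (hα : -1 < α) (h : α + 2 < 2 * lam) :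
    Tendsto
      (fun r : ℝ =>
        (1 - r ^ 2) ^ (2 * lam - α - 2) *
          bergmanNormSq α (fun z : ℂ => (1 - (r : ℂ) * z) ^ (-(lam : ℂ))))
      (nhdsWithin 1 (Set.Ioo (0 : ℝ) 1))
      (nhds (Real.Gamma (α + 2) * Real.Gamma (2 * lam - α - 2) / Real.Gamma lam ^ 2)) := by
  have hratio := ratio_tendsto (a := α + 2) (s := 2 * lam - α - 2) (l := lam) (by linarith)
    (by linarith) (by linarith) (by ring)
  have hab := abelian (by linarith) hratio
  have hsq : Tendsto (fun r : ℝ => r ^ 2) (nhdsWithin 1 (Set.Ioo (0 : ℝ) 1))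
      (nhdsWithin 1 (Set.Ioo (0 : ℝ) 1)) := by
    refine tendsto_nhdsWithin_of_tendsto_nhds_of_eventually_within _ ?_ ?_
    · have : ContinuousAt (fun r : ℝ => r ^ 2) 1 := by fun_prop
      have h2 := this.tendsto
      simp only [one_pow] at h2
      exact h2.mono_left nhdsWithin_le_nhds
    · filter_upwards [self_mem_nhdsWithin] with r hr
      exact ⟨by have := hr.1; positivity, by nlinarith [hr.1, hr.2]⟩
  refine (hab.comp hsq).congr' ?_
  filter_upwards [self_mem_nhdsWithin] with r hr
  rw [bergman_eq hα h hr]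
  rfl
end

section
/- Let α > -1, β > α, and g₀(z) = (1-z²)^{-(β-α)/2}. Then the multiplier norm of g₀ from A²_α to A²_β satisfies ‖g₀‖²_{M_{α,β}} = 2^{α-β} · (Γ(β+2)/Γ(α+2)) · (Γ(1+α/2)/Γ(1+β/2))². -/
open MeasureTheory Complex Real

/-- Membership in the weighted Bergman space `A²_α`. -/
def MemBergman (α : ℝ) (φ : ℂ → ℂ) : Prop :=
  DifferentiableOn ℂ φ (Metric.ball (0 : ℂ) 1) ∧
    IntegrableOn (fun z : ℂ => ‖φ z‖ ^ 2 * (1 - ‖z‖ ^ 2) ^ α) (Metric.ball (0 : ℂ) 1)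

/-- The square of the multiplier norm of `g` from `A²_α` to `A²_β`. -/
noncomputable def multNormSq (α β : ℝ) (g : ℂ → ℂ) : ℝ :=
  sSup {t : ℝ | ∃ φ : ℂ → ℂ, MemBergman α φ ∧ bergmanNormSq α φ ≠ 0 ∧
    t = bergmanNormSq β (fun z => g z * φ z) / bergmanNormSq α φ}


/-- value of the cosine integral -/
noncomputable def cosI (a : ℝ) : ℝ := π * 2 ^ (-a) * Real.Gamma (a + 1) / Real.Gamma (1 + a / 2) ^ 2

lemma cosI_pos {a : ℝ} (ha : -1 < a) : 0 < cosI a := by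
  have h1 := Real.Gamma_pos_of_pos (s := a + 1) (by linarith)
  have h2 := Real.Gamma_pos_of_pos (s := 1 + a / 2) (by linarith)
  have h3 := Real.pi_pos
  unfold cosI
  positivity

lemma image_sin : (fun u : ℝ => (1 + Real.sin u) / 2) '' Set.Ioo (-(π / 2)) (π / 2) = Set.Ioo 0 1 := by
  ext x
  constructor
  · rintro ⟨u, hu, rfl⟩
    have h1 : Real.sin u < 1 := by
      rw [← Real.sin_pi_div_two]
      exact Real.sin_lt_sin_of_lt_of_le_pi_div_two hu.1.le le_rfl hu.2
    have h2 : -1 < Real.sin u := by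
      rw [← Real.sin_pi_div_two, ← Real.sin_neg]
      exact Real.sin_lt_sin_of_lt_of_le_pi_div_two le_rfl hu.2.le hu.1
    constructor <;> simp <;> linarith
  · intro hx
    refine ⟨Real.arcsin (2 * x - 1), ⟨Real.neg_pi_div_two_lt_arcsin.2 (by linarith [hx.1]),
      Real.arcsin_lt_pi_div_two.2 (by linarith [hx.2])⟩, ?_⟩
    simp only
    rw [Real.sin_arcsin (by linarith [hx.1]) (by linarith [hx.2])]
    ring

lemma lintegral_cos {a : ℝ} (ha : -1 < a) :
    ∫⁻ u in Set.Ioo (-(π / 2)) (π / 2), ENNReal.ofReal (Real.cos u ^ a) = ENNReal.ofReal (cosI a) := by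
  set s := (a + 1) / 2 with hs
  have hs0 : 0 < s := by rw [hs]; linarith
  have hB := ProbabilityTheory.beta_pos hs0 hs0
  have h1 := ProbabilityTheory.lintegral_betaPDF_eq_one hs0 hs0
  rw [ProbabilityTheory.lintegral_betaPDF, ← image_sin,
    lintegral_image_eq_lintegral_abs_deriv_mul measurableSet_Ioo
    (f' := fun u => Real.cos u / 2)] at h1
  rotate_left
  · intro x _
    have := ((Real.hasDerivAt_sin x).const_add 1).div_const 2
    exact this.hasDerivWithinAt
  · intro x hx y hy h
    simp only at h
    exact Real.injOn_sin (Set.Ioo_subset_Icc_self hx) (Set.Ioo_subset_Icc_self hy) (by linarith)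
  have key : ∀ u ∈ Set.Ioo (-(π / 2)) (π / 2), ENNReal.ofReal (Real.cos u ^ a) =
      ENNReal.ofReal (2 ^ a * ProbabilityTheory.beta s s) * (ENNReal.ofReal |Real.cos u / 2| * ENNReal.ofReal (1 / ProbabilityTheory.beta s s *
        ((1 + Real.sin u) / 2) ^ (s - 1) * (1 - (1 + Real.sin u) / 2) ^ (s - 1))) := by
    intro u hu
    have hc := Real.cos_pos_of_mem_Ioo hu
    have hx : (1 + Real.sin u) / 2 ∈ Set.Ioo (0:ℝ) 1 := by
      rw [← image_sin]; exact ⟨u, hu, rfl⟩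
    rw [← ENNReal.ofReal_mul (by positivity), ← ENNReal.ofReal_mul (by positivity),
      abs_of_pos (by positivity), mul_assoc (1 / _), ← Real.mul_rpow hx.1.le (by linarith [hx.2])]
    have e : (1 + Real.sin u) / 2 * (1 - (1 + Real.sin u) / 2) = (Real.cos u / 2) ^ (2:ℝ) := by
      have := Real.sin_sq_add_cos_sq u
      rw [Real.rpow_two]
      nlinarith
    rw [e, ← Real.rpow_mul (by positivity)]
    congr 1
    have e2 : Real.cos u / 2 * (1 / ProbabilityTheory.beta s s * (Real.cos u / 2) ^ (2 * (s - 1))) =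
       1 / ProbabilityTheory.beta s s * (Real.cos u / 2) ^ a := by
      have : (Real.cos u / 2) ^ a = (Real.cos u / 2) * (Real.cos u / 2) ^ (2 * (s - 1)) := by
        rw [show a = 1 + 2 * (s - 1) by rw [hs]; ring, Real.rpow_add (by positivity), Real.rpow_one]
      rw [this]; ring
    rw [e2, Real.div_rpow hc.le (by norm_num)]
    field_simp
  rw [setLIntegral_congr_fun measurableSet_Ioo key, lintegral_const_mul' _ _ ENNReal.ofReal_ne_top, h1, mul_one]
  congr 1
  unfold cosI ProbabilityTheory.beta
  have hd := Real.Gamma_mul_Gamma_add_half s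
  have e1 : s + 1 / 2 = 1 + a / 2 := by rw [hs]; ring
  have e2 : 2 * s = a + 1 := by rw [hs]; ring
  rw [e1, e2, show 1 - (a + 1) = -a by ring] at hd
  rw [show s + s = a + 1 by rw [hs]; ring]
  have g1 := Real.Gamma_pos_of_pos (s := a + 1) (by linarith)
  have g2 := Real.Gamma_pos_of_pos (s := 1 + a / 2) (by linarith)
  have hp : (2:ℝ) ^ a * 2 ^ (-a) = 1 := by rw [← Real.rpow_add (by norm_num)]; simp
  have hpi := Real.sq_sqrt Real.pi_pos.le
  rw [← mul_div_assoc, div_eq_div_iff (by positivity) (by positivity)]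
  calc _ = 2 ^ a * (Real.Gamma s * Real.Gamma (1 + a/2)) ^ 2 := by ring
    _ = ((2:ℝ) ^ a * 2 ^ (-a)) * (2 ^ (-a) * Real.Gamma (a+1) ^ 2 * (√π) ^ 2) := by rw [hd]; ring
    _ = _ := by rw [hp, hpi]; ring

lemma cos_const {α β : ℝ} (hα : -1 < α) (hβ : α < β) :
    (β + 1) / (α + 1) * (cosI β / cosI α) = 2 ^ (α - β) * (Real.Gamma (β + 2) / Real.Gamma (α + 2)) *
        (Real.Gamma (1 + α / 2) / Real.Gamma (1 + β / 2)) ^ 2 := by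
  unfold cosI
  have g1 := Real.Gamma_pos_of_pos (s := α + 1) (by linarith)
  have g2 := Real.Gamma_pos_of_pos (s := 1 + α / 2) (by linarith)
  have g3 := Real.Gamma_pos_of_pos (s := β + 1) (by linarith)
  have g4 := Real.Gamma_pos_of_pos (s := 1 + β / 2) (by linarith)
  rw [show β + 2 = (β + 1) + 1 by ring, show α + 2 = (α + 1) + 1 by ring,
    Real.Gamma_add_one (s := β + 1) (by linarith), Real.Gamma_add_one (s := α + 1) (by linarith), Real.rpow_sub (by norm_num),
    Real.rpow_neg (by norm_num), Real.rpow_neg (by norm_num)]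
  have : α + 1 ≠ 0 := by linarith
  have := Real.pi_pos
  field_simp

lemma chebyshev_aux {X : Type*} [MeasurableSpace X] (μ : Measure X) [IsFiniteMeasure μ] (n p : X → ℝ)
    (hn : Integrable n μ) (hp : Integrable p μ) (hnp : Integrable (fun x => n x * p x) μ)
    (E : Set X) (hE : ∀ᵐ x ∂μ, x ∈ E)
    (h : ∀ u ∈ E, ∀ v ∈ E, (n u - n v) * (p u - p v) ≤ 0) :
    (∫ x, n x * p x ∂μ) * μ.real Set.univ ≤ (∫ x, n x ∂μ) * ∫ x, p x ∂μ := by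
  set m := μ.real Set.univ
  set J := ∫ x, n x * p x ∂μ with hJ
  set I := ∫ x, n x ∂μ with hI
  set P := ∫ x, p x ∂μ with hP
  have h1 : ∀ u ∈ E, n u * p u * m - n u * P - p u * I + J ≤ 0 := by
    intro u hu
    have : ∫ v, (n u - n v) * (p u - p v) ∂μ ≤ 0 :=
      integral_nonpos_of_ae (by filter_upwards [hE] with v hv using h u hu v hv)
    have e : (fun v => (n u - n v) * (p u - p v)) = fun v => n u * p u - n u * p v - p u * n v + n v * p v := by
      ext v; ring
    rw [e, integral_add (by fun_prop) hnp, integral_sub (by fun_prop) (by fun_prop),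
      integral_sub (by fun_prop) (by fun_prop), integral_const_mul (n u) p, integral_const_mul (p u) n, integral_const,
      smul_eq_mul] at this
    change m * (n u * p u) - n u * P - p u * I + J ≤ 0 at this
    linarith
  have h2 : ∫ u, (n u * p u * m - n u * P - p u * I + J) ∂μ ≤ 0 :=
    integral_nonpos_of_ae (by filter_upwards [hE] with u hu using h1 u hu)
  rw [integral_add (by fun_prop) (by fun_prop), integral_sub (by fun_prop) (by fun_prop),
      integral_sub (by fun_prop) (by fun_prop), integral_mul_const, integral_mul_const, integral_mul_const, integral_const,
      smul_eq_mul] at h2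
  change J * m - I * P - P * I + m * J ≤ 0 at h2
  linarith

lemma smooth_eq (N : ℝ → ENNReal) (u δ : ℝ) :
    ∫⁻ x in Set.Ioo (-δ) δ, N (u + x) = ∫⁻ x in Set.Ioo (u - δ) (u + δ), N x := by
  have := (measurePreserving_add_left volume u).setLIntegral_comp_preimage_emb
    (measurableEmbedding_addLeft u) N (Set.Ioo (u - δ) (u + δ))
  rw [← this]
  congr 2
  ext x; simp

lemma smooth_even (N : ℝ → ENNReal) (heven : ∀ u, N (-u) = N u) (u δ : ℝ) :
    ∫⁻ x in Set.Ioo (-δ) δ, N (-u + x) = ∫⁻ x in Set.Ioo (-δ) δ, N (u + x) := by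
  have := (Measure.measurePreserving_neg (volume : Measure ℝ)).setLIntegral_comp_preimage_emb
    (MeasurableEquiv.neg ℝ).measurableEmbedding (fun x => N (-u + x)) (Set.Ioo (-δ) δ)
  rw [← this]
  have e : Neg.neg ⁻¹' Set.Ioo (-δ) δ = Set.Ioo (-δ) δ := by ext x; simp [and_comm]
  rw [e]
  congr 1
  ext x
  rw [← heven]; congr 1; ring

lemma smooth_mono (N : ℝ → ENNReal) (hN : Measurable N) (heven : ∀ u, N (-u) = N u) (b : ℝ)
    (hfin : ∀ a < b, ∫⁻ u in Set.Ioo (-a) a, N u < ⊤)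
    (hsub : ∀ u r, 0 ≤ r → |u| + r < b →
      ENNReal.ofReal (2 * π) * N u ≤ ∫⁻ θ in Set.Ioc 0 (2 * π), N (u + r * Real.sin θ))
    (δ u v : ℝ) (hδ : 0 < δ) (huv : |u| ≤ |v|) (hv : |v| + δ < b) :
    ∫⁻ x in Set.Ioo (u - δ) (u + δ), N x ≤ ∫⁻ x in Set.Ioo (v - δ) (v + δ), N x := by
  set a := |v| with ha
  have ha0 : 0 ≤ a := abs_nonneg v
  set D : ℝ → ENNReal := fun u => ∫⁻ x in Set.Ioo (-δ) δ, N (u + x) with hD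
  have hDeven : ∀ u, D (-u) = D u := fun u => smooth_even N heven u δ
  have hDabs : ∀ u, D |u| = D u := by
    intro u
    rcases abs_choice u with h | h <;> rw [h]
    exact hDeven u
  obtain ⟨c, hc1, hc2⟩ := exists_between hv
  set n : ℝ → ℝ := (Set.Ioo (-c) c).indicator (fun x => (N x).toReal) with hn
  have hnint : Integrable n := by
    rw [hn, integrable_indicator_iff measurableSet_Ioo]
    exact integrable_toReal_of_lintegral_ne_top hN.aemeasurable (hfin c hc2).ne
  set d : ℝ → ℝ := fun u => ∫ x in (u - δ)..(u + δ), n x with hd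
  have hdc : Continuous d := by
    have hF := intervalIntegral.continuous_primitive (fun a b => hnint.intervalIntegrable (a := a) (b := b)) 0
    have : d = fun u => (∫ x in (0:ℝ)..(u + δ), n x) - ∫ x in (0:ℝ)..(u - δ), n x := by
      ext u
      rw [intervalIntegral.integral_interval_sub_left hnint.intervalIntegrable hnint.intervalIntegrable]
    rw [this]
    exact (hF.comp (continuous_id.add continuous_const)).sub (hF.comp (continuous_id.sub continuous_const))
  have hDd : ∀ u, |u| ≤ a → D u = ENNReal.ofReal (d u) := by
    intro u hu
    have hsubset : Set.Ioo (u - δ) (u + δ) ⊆ Set.Ioo (-c) c := by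
      have := abs_le.1 hu
      apply Set.Ioo_subset_Ioo <;> linarith
    have hlt : ∫⁻ x in Set.Ioo (u - δ) (u + δ), N x < ⊤ :=
      lt_of_le_of_lt (lintegral_mono_set hsubset) (hfin c hc2)
    simp only [hD, hd]
    rw [smooth_eq, intervalIntegral.integral_of_le (by linarith), integral_Ioc_eq_integral_Ioo,
      setIntegral_congr_fun measurableSet_Ioo (g := fun x => (N x).toReal)
        (fun x hx => Set.indicator_of_mem (hsubset hx) _),
      integral_toReal hN.aemeasurable (ae_lt_top hN hlt.ne), ENNReal.ofReal_toReal hlt.ne]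
  have hd0 : ∀ u, 0 ≤ d u := by
    intro u
    apply intervalIntegral.integral_nonneg (by linarith)
    intro x _
    exact Set.indicator_nonneg (fun _ _ => ENNReal.toReal_nonneg) _
  -- sub mean value property of D
  have hDsub : ∀ u r, 0 ≤ r → |u| + r ≤ a →
      2 * π * d u ≤ ∫ θ in (0:ℝ)..(2 * π), d (u + r * Real.sin θ) := by
    intro u r hr hur
    have hs : ∀ θ, |u + r * Real.sin θ| ≤ a := by
      intro θ
      calc _ ≤ |u| + |r * Real.sin θ| := abs_add_le _ _
        _ ≤ |u| + r := by
          rw [abs_mul, abs_of_nonneg hr]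
          have := mul_le_mul_of_nonneg_left (Real.abs_sin_le_one θ) hr
          linarith
        _ ≤ a := hur
    have h1 : ENNReal.ofReal (2 * π) * D u ≤ ∫⁻ θ in Set.Ioc 0 (2 * π), D (u + r * Real.sin θ) := by
      simp only [hD]
      rw [← lintegral_const_mul' _ _ ENNReal.ofReal_ne_top]
      rw [lintegral_lintegral_swap]
      · apply setLIntegral_mono' measurableSet_Ioo
        intro x hx
        have := hsub (u + x) r hr (by
          have : |u + x| ≤ |u| + |x| := abs_add_le _ _
          have : |x| < δ := abs_lt.2 hx
          linarith)
        refine this.trans (le_of_eq ?_)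
        congr 1; ext θ; congr 1; ring
      · have : Measurable (fun q : ℝ × ℝ => N (u + r * Real.sin q.1 + q.2)) := by fun_prop
        exact this.aemeasurable
    have h2 : ∫⁻ θ in Set.Ioc 0 (2 * π), D (u + r * Real.sin θ) =
        ENNReal.ofReal (∫ θ in (0:ℝ)..(2 * π), d (u + r * Real.sin θ)) := by
      have hcont : Continuous fun θ => d (u + r * Real.sin θ) := by fun_prop
      rw [intervalIntegral.integral_of_le (by positivity),
        ofReal_integral_eq_lintegral_ofReal (hcont.integrableOn_Ioc) (ae_of_all _ fun θ => hd0 _)]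
      congr 1; ext θ; exact hDd _ (hs θ)
    rw [h2, hDd u (by linarith), ← ENNReal.ofReal_mul (by positivity)] at h1
    rwa [ENNReal.ofReal_le_ofReal_iff] at h1
    exact intervalIntegral.integral_nonneg (by positivity) (fun θ _ => hd0 _)
  have hdabs : ∀ u, |u| ≤ a → d |u| = d u := by
    intro u hu
    have h1 := hDd u hu
    have h2 := hDd |u| (by rwa [abs_abs])
    rw [hDabs, h1, ENNReal.ofReal_eq_ofReal_iff (hd0 _) (hd0 _)] at h2
    exact h2.symm
  obtain ⟨u0, hu0, hmax⟩ := (isCompact_Icc (a := (0:ℝ)) (b := a)).exists_isMaxOn ⟨0, by simp [ha0]⟩ hdc.continuousOn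
  have hmax' : ∀ w, |w| ≤ a → d w ≤ d u0 := by
    intro w hw
    rw [← hdabs w hw]
    exact hmax ⟨abs_nonneg w, hw⟩
  have hda : d u0 ≤ d a := by
    by_contra hlt
    push Not at hlt
    have hs := hDsub u0 (a - u0) (by linarith [hu0.2]) (by rw [abs_of_nonneg hu0.1]; linarith)
    have hpos : 0 < ∫ θ in (0:ℝ)..(2 * π), (d u0 - d (u0 + (a - u0) * Real.sin θ)) := by
      apply intervalIntegral.integral_pos (by positivity)
      · fun_prop
      · intro θ _
        have := hmax' (u0 + (a - u0) * Real.sin θ) (by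
          have h1 := Real.neg_one_le_sin θ
          have h2 := Real.sin_le_one θ
          rw [abs_le]; constructor <;> nlinarith [hu0.1, hu0.2])
        linarith
      · refine ⟨π / 2, ⟨by positivity, by linarith [Real.pi_pos]⟩, ?_⟩
        simp; linarith
    rw [intervalIntegral.integral_sub (by simp) (by
      apply Continuous.intervalIntegrable; fun_prop)] at hpos
    simp at hpos
    linarith
  rw [← smooth_eq, ← smooth_eq]
  change D u ≤ D v
  rw [← hDabs v, hDd u huv, hDd |v| (by rw [abs_abs])]
  exact ENNReal.ofReal_le_ofReal ((hmax' u huv).trans hda)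

lemma ae_mono (N : ℝ → ENNReal) (hN : Measurable N) (heven : ∀ u, N (-u) = N u) (b : ℝ)
    (hfin : ∀ a < b, ∫⁻ u in Set.Ioo (-a) a, N u < ⊤)
    (hsub : ∀ u r, 0 ≤ r → |u| + r < b →
      ENNReal.ofReal (2 * π) * N u ≤ ∫⁻ θ in Set.Ioc 0 (2 * π), N (u + r * Real.sin θ)) :
    ∃ E : Set ℝ, (∀ᵐ u, u ∈ Set.Ioo (-b) b → u ∈ E) ∧
      ∀ u ∈ E, ∀ v ∈ E, |u| ≤ |v| → (N u).toReal ≤ (N v).toReal := by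
  set n : ℝ → ℝ := fun x => (N x).toReal with hn
  set P : ℝ → ℝ → ℝ := fun u δ => ∫ x in (u - δ)..(u + δ), n x with hP
  refine ⟨{u | |u| < b ∧ Filter.Tendsto (fun δ => P u δ / (2 * δ)) (nhdsWithin 0 (Set.Ioi 0)) (nhds (n u))}, ?_, ?_⟩
  · have h1 : ∀ k : ℕ, ∀ᵐ u, |u| < b - 1 / (k + 1) →
        Filter.Tendsto (fun δ => P u δ / (2 * δ)) (nhdsWithin 0 (Set.Ioi 0)) (nhds (n u)) := by
      intro k
      set a := b - 1 / ((k:ℝ) + 1) with ha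
      have hab : a < b := by rw [ha]; have : 0 < 1 / ((k:ℝ) + 1) := by positivity
                             linarith
      rcases le_or_gt a 0 with h0 | h0
      · exact ae_of_all _ fun u hu => absurd (abs_nonneg u) (by linarith)
      have hInt : IntervalIntegrable n volume (-a) a := by
        rw [intervalIntegrable_iff_integrableOn_Ioo_of_le (by linarith)]
        exact integrable_toReal_of_lintegral_ne_top hN.aemeasurable (hfin a hab).ne
      have hsubint : ∀ x y, x ∈ Set.Icc (-a) a → y ∈ Set.Icc (-a) a → IntervalIntegrable n volume x y := by
        intro x y hx hy
        apply hInt.mono_set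
        rw [Set.uIcc_of_le (by linarith : -a ≤ a)]
        exact Set.ordConnected_Icc.uIcc_subset hx hy
      filter_upwards [hInt.ae_hasDerivAt_integral] with u hu hua
      rw [Set.uIcc_of_le (by linarith)] at hu
      have hu' := abs_lt.1 hua
      have hd := hu ⟨hu'.1.le, hu'.2.le⟩ 0 ⟨by linarith, by linarith⟩
      set F := fun x => ∫ t in (0:ℝ)..x, n t with hF
      have hg : HasDerivAt (fun δ => F (u + δ) - F (u - δ)) (2 * n u) 0 := by
        have h1 : HasDerivAt (fun δ => F (u + δ)) (n u) 0 := by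
          apply HasDerivAt.comp_const_add; simpa using hd
        have h2 : HasDerivAt (fun δ => F (u - δ)) (- n u) 0 := by
          apply HasDerivAt.comp_const_sub; simpa using hd
        convert! h1.sub h2 using 1; ring
      rw [hasDerivAt_iff_tendsto_slope] at hg
      have hg2 := (hg.mono_left (nhdsWithin_mono _ (by intro x (hx : 0 < x); exact hx.ne' :
        Set.Ioi (0:ℝ) ⊆ {0}ᶜ))).const_mul (1/2)
      rw [show 1 / 2 * (2 * n u) = n u by ring] at hg2
      refine hg2.congr' ?_
      have hs : Set.Ioo 0 (a - |u|) ∈ nhdsWithin (0:ℝ) (Set.Ioi 0) := Ioo_mem_nhdsGT (by linarith)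
      filter_upwards [hs] with δ hδ
      have hua1 := le_abs_self u
      have hua2 := neg_abs_le u
      simp only [slope, hF, hP]
      rw [intervalIntegral.integral_interval_sub_left (hsubint _ _ ⟨by linarith, by linarith⟩ ⟨by linarith [hδ.1], by linarith [hδ.2]⟩)
        (hsubint _ _ ⟨by linarith, by linarith⟩ ⟨by linarith [hδ.2], by linarith [hδ.1]⟩)]
      simp
      have := hδ.1.ne'
      field_simp
    rw [← ae_all_iff] at h1
    filter_upwards [h1] with u hu hub
    have hub' : |u| < b := abs_lt.2 hub
    obtain ⟨k, hk⟩ := exists_nat_one_div_lt (sub_pos.2 hub')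
    exact ⟨hub', hu k (by linarith)⟩
  · rintro u ⟨hu, hu'⟩ v ⟨hv, hv'⟩ huv
    refine le_of_tendsto_of_tendsto hu' hv' ?_
    have hs : Set.Ioo 0 (b - |v|) ∈ nhdsWithin (0:ℝ) (Set.Ioi 0) := Ioo_mem_nhdsGT (by linarith)
    filter_upwards [hs] with δ hδ
    have hm := smooth_mono N hN heven b hfin hsub δ u v hδ.1 huv (by linarith [hδ.2])
    have hfinw : ∀ w, |w| ≤ |v| → ∫⁻ x in Set.Ioo (w - δ) (w + δ), N x < ⊤ := by
      intro w hw
      obtain ⟨c, hc1, hc2⟩ := exists_between (show |v| + δ < b by linarith [hδ.2])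
      refine lt_of_le_of_lt (lintegral_mono_set ?_) (hfin c hc2)
      have := abs_le.1 hw
      apply Set.Ioo_subset_Ioo <;> linarith
    have hPw : ∀ w, |w| ≤ |v| → P w δ = (∫⁻ x in Set.Ioo (w - δ) (w + δ), N x).toReal := by
      intro w hw
      simp only [hP, hn]
      rw [intervalIntegral.integral_of_le (by linarith [hδ.1]), integral_Ioc_eq_integral_Ioo,
        integral_toReal hN.aemeasurable (ae_lt_top hN (hfinw w hw).ne)]
    rw [hPw u huv, hPw v le_rfl]
    have := hδ.1
    gcongr
    exact (hfinw v le_rfl).ne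

lemma chebyshev_enn {X : Type*} [MeasurableSpace X] (μ : Measure X) [IsFiniteMeasure μ] (N p : X → ENNReal)
    (hN : Measurable N) (hp : Measurable p) (hNfin : ∫⁻ x, N x ∂μ ≠ ⊤) 
    (E : Set X) (hE : ∀ᵐ x ∂μ, x ∈ E) (hp1 : ∀ᵐ x ∂μ, p x ≤ 1)
    (h : ∀ u ∈ E, ∀ v ∈ E, ((N u).toReal - (N v).toReal) * ((p u).toReal - (p v).toReal) ≤ 0) :
    (∫⁻ x, N x * p x ∂μ) * μ Set.univ ≤ (∫⁻ x, N x ∂μ) * ∫⁻ x, p x ∂μ := by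
  have hpfin : ∫⁻ x, p x ∂μ ≠ ⊤ := by
    have : ∫⁻ x, p x ∂μ ≤ ∫⁻ x, 1 ∂μ := lintegral_mono_ae hp1
    refine (this.trans_lt ?_).ne
    simp
  have hNpfin : ∫⁻ x, N x * p x ∂μ ≠ ⊤ := by
    have : ∫⁻ x, N x * p x ∂μ ≤ ∫⁻ x, N x ∂μ := by
      apply lintegral_mono_ae
      filter_upwards [hp1] with x hx
      calc N x * p x ≤ N x * 1 := by gcongr
        _ = N x := mul_one _
    exact (this.trans_lt hNfin.lt_top).ne
  have i1 := integrable_toReal_of_lintegral_ne_top hN.aemeasurable hNfin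
  have i2 := integrable_toReal_of_lintegral_ne_top hp.aemeasurable hpfin
  have hNp : Measurable (fun x => N x * p x) := hN.mul hp
  have i3 := integrable_toReal_of_lintegral_ne_top hNp.aemeasurable hNpfin
  have := chebyshev_aux μ (fun x => (N x).toReal) (fun x => (p x).toReal) i1 i2 
    (by simpa only [ENNReal.toReal_mul] using i3) E hE h
  simp only [← ENNReal.toReal_mul] at this
  rw [integral_toReal hN.aemeasurable (ae_lt_top hN hNfin), integral_toReal hp.aemeasurable (ae_lt_top hp hpfin),
    integral_toReal hNp.aemeasurable (ae_lt_top hNp hNpfin), Measure.real, ← ENNReal.toReal_mul,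
    ← ENNReal.toReal_mul] at this
  rwa [ENNReal.toReal_le_toReal] at this
  · exact ENNReal.mul_ne_top hNpfin (measure_ne_top _ _)
  · exact ENNReal.mul_ne_top hNfin hpfin

/-- the horizontal strip -/
def strip : Set ℂ := {ζ | ζ.im ∈ Set.Ioo (-(π / 2)) (π / 2)}

lemma isOpen_strip : IsOpen strip := isOpen_Ioo.preimage Complex.continuous_im

lemma mean_ineq (f : ℂ → ℂ) (hf : DifferentiableOn ℂ f strip) (ζ : ℂ) (R : ℝ) (hR : |ζ.im| + |R| < π / 2) :
    2 * π * ‖f ζ‖ ^ 2 ≤ ∫ θ in (0:ℝ)..(2 * π), ‖f (circleMap ζ R θ)‖ ^ 2 := by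
  have hsub : Metric.closedBall ζ |R| ⊆ strip := by
    intro w hw
    have h1 : |(w - ζ).im| ≤ |R| := (Complex.abs_im_le_norm _).trans (by simpa [dist_eq_norm] using hw)
    have h2 : |w.im| ≤ |ζ.im| + |(w - ζ).im| := by
      have := abs_add_le ζ.im (w - ζ).im
      simpa using this
    exact abs_lt.1 (by linarith : |w.im| < π / 2)
  have hd : DiffContOnCl ℂ (fun w => f w ^ 2) (Metric.ball ζ |R|) := by
    apply DifferentiableOn.diffContOnCl
    apply DifferentiableOn.pow
    exact hf.mono ((Metric.closure_ball_subset_closedBall).trans hsub)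
  have := hd.circleAverage
  rw [Real.circleAverage_def] at this
  have h3 : ‖f ζ‖ ^ 2 = (2 * π)⁻¹ * ‖∫ θ in (0:ℝ)..(2 * π), f (circleMap ζ R θ) ^ 2‖ := by
    rw [← norm_pow, ← this, norm_smul, Real.norm_of_nonneg (by positivity)]
  have h4 := intervalIntegral.norm_integral_le_integral_norm (μ := volume) (f := fun θ => f (circleMap ζ R θ) ^ 2)
    (a := 0) (b := 2 * π) (by positivity)
  simp only [norm_pow] at h4
  rw [h3]
  have := Real.pi_pos
  rw [← mul_assoc, mul_inv_cancel₀ (by positivity), one_mul]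
  exact h4

/-- the density -/
noncomputable def hh (f : ℂ → ℂ) : ℂ → ENNReal := strip.indicator (fun ζ => ENNReal.ofReal (‖f ζ‖ ^ 2))

lemma measurable_hh (f : ℂ → ℂ) (hf : DifferentiableOn ℂ f strip) : Measurable (hh f) := by
  have h1 : ContinuousOn (fun ζ => ENNReal.ofReal (‖f ζ‖ ^ 2)) strip :=
    ENNReal.continuous_ofReal.comp_continuousOn (hf.continuousOn.norm.pow 2)
  classical
  have := h1.measurable_piecewise (g := (0 : ℂ → ENNReal)) continuousOn_const isOpen_strip.measurableSet
  rw [Set.piecewise_eq_indicator] at this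
  exact this

/-- line integrals -/
noncomputable def MM (f : ℂ → ℂ) (u : ℝ) : ENNReal := ∫⁻ t : ℝ, hh f ⟨t, u⟩

lemma measurable_mk : Measurable (fun q : ℝ × ℝ => (⟨q.1, q.2⟩ : ℂ)) :=
  Complex.measurableEquivRealProd.symm.measurable

lemma measurable_MM (f : ℂ → ℂ) (hf : DifferentiableOn ℂ f strip) : Measurable (MM f) :=
  Measurable.lintegral_prod_left' (f := fun q : ℝ × ℝ => hh f ⟨q.1, q.2⟩)
    ((measurable_hh f hf).comp measurable_mk)

lemma hh_sub (f : ℂ → ℂ) (hf : DifferentiableOn ℂ f strip) (t u r : ℝ) (hr : |u| + |r| < π / 2) :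
    ENNReal.ofReal (2 * π) * hh f ⟨t, u⟩ ≤
      ∫⁻ θ in Set.Ioc 0 (2 * π), hh f ⟨t + r * Real.cos θ, u + r * Real.sin θ⟩ := by
  have hmem : ∀ θ, (⟨t + r * Real.cos θ, u + r * Real.sin θ⟩ : ℂ) ∈ strip := by
    intro θ
    have h1 : |u + r * Real.sin θ| ≤ |u| + |r| := by
      refine (abs_add_le _ _).trans ?_
      rw [abs_mul]
      have := mul_le_mul_of_nonneg_left (Real.abs_sin_le_one θ) (abs_nonneg r)
      linarith
    exact abs_lt.1 (by linarith : |u + r * Real.sin θ| < π / 2)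
  have hmem0 : (⟨t, u⟩ : ℂ) ∈ strip := abs_lt.1 (by linarith [abs_nonneg r] : |u| < π / 2)
  have hcm : ∀ θ, circleMap ⟨t, u⟩ r θ = ⟨t + r * Real.cos θ, u + r * Real.sin θ⟩ := by
    intro θ
    apply Complex.ext <;> simp [circleMap, Complex.exp_ofReal_mul_I_re, Complex.exp_ofReal_mul_I_im]
  have h := mean_ineq f hf ⟨t, u⟩ r hr
  simp only [hcm] at h
  have hc : Continuous (fun θ : ℝ => ‖f ⟨t + r * Real.cos θ, u + r * Real.sin θ⟩‖ ^ 2) := by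
    have : Continuous (fun θ : ℝ => f (circleMap ⟨t, u⟩ r θ)) :=
      hf.continuousOn.comp_continuous (continuous_circleMap _ _) (fun θ => by rw [hcm]; exact hmem θ)
    simp only [hcm] at this
    exact this.norm.pow 2
  rw [hh, Set.indicator_of_mem hmem0, ← ENNReal.ofReal_mul (by positivity)]
  simp only [Set.indicator_of_mem (hmem _)]
  rw [intervalIntegral.integral_of_le (by positivity)] at h
  rw [← ofReal_integral_eq_lintegral_ofReal hc.integrableOn_Ioc (ae_of_all _ fun θ => by positivity)]
  exact ENNReal.ofReal_le_ofReal h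

lemma MM_sub (f : ℂ → ℂ) (hf : DifferentiableOn ℂ f strip) (u r : ℝ) (hr : |u| + |r| < π / 2) :
    ENNReal.ofReal (2 * π) * MM f u ≤ ∫⁻ θ in Set.Ioc 0 (2 * π), MM f (u + r * Real.sin θ) := by
  have h1 : ∀ θ, MM f (u + r * Real.sin θ) = ∫⁻ t : ℝ, hh f ⟨t + r * Real.cos θ, u + r * Real.sin θ⟩ := by
    intro θ
    rw [MM, lintegral_add_right_eq_self (fun t : ℝ => hh f ⟨t, u + r * Real.sin θ⟩)]
  simp only [h1]
  rw [lintegral_lintegral_swap]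
  · rw [MM, ← lintegral_const_mul' _ _ ENNReal.ofReal_ne_top]
    exact lintegral_mono fun t => hh_sub f hf t u r hr
  · have : Measurable (fun q : ℝ × ℝ => hh f ⟨q.2 + r * Real.cos q.1, u + r * Real.sin q.1⟩) := by
      have h2 : Measurable (fun q : ℝ × ℝ => (q.2 + r * Real.cos q.1, u + r * Real.sin q.1)) := by fun_prop
      exact ((measurable_hh f hf).comp measurable_mk).comp h2
    exact this.aemeasurable

lemma strip_iter (f : ℂ → ℂ) (hf : DifferentiableOn ℂ f strip) (a : ℝ) :
    ∫⁻ ζ in strip, ENNReal.ofReal (‖f ζ‖ ^ 2 * Real.cos ζ.im ^ a) =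
      ∫⁻ u in Set.Ioo (-(π / 2)) (π / 2), MM f u * ENNReal.ofReal (Real.cos u ^ a) := by
  have hm : Measurable (fun ζ : ℂ => hh f ζ * ENNReal.ofReal (Real.cos ζ.im ^ a)) := by
    refine (measurable_hh f hf).mul ?_
    have := Complex.measurable_im
    fun_prop
  have e1 : ∫⁻ ζ in strip, ENNReal.ofReal (‖f ζ‖ ^ 2 * Real.cos ζ.im ^ a) =
      ∫⁻ ζ, hh f ζ * ENNReal.ofReal (Real.cos ζ.im ^ a) := by
    rw [← lintegral_indicator isOpen_strip.measurableSet]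
    congr 1; ext ζ
    by_cases h : ζ ∈ strip
    · rw [hh, Set.indicator_of_mem h, Set.indicator_of_mem h, ENNReal.ofReal_mul (by positivity)]
    · rw [hh, Set.indicator_of_notMem h, Set.indicator_of_notMem h, zero_mul]
  rw [e1, ← Complex.volume_preserving_equiv_real_prod.symm.lintegral_comp hm, Measure.volume_eq_prod,
    lintegral_prod_symm' (fun q : ℝ × ℝ => hh f (measurableEquivRealProd.symm q) *
        ENNReal.ofReal (Real.cos (measurableEquivRealProd.symm q).im ^ a))
      (hm.comp Complex.measurableEquivRealProd.symm.measurable),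
    ← lintegral_indicator measurableSet_Ioo]
  congr 1; ext u
  have e2 : ∀ t : ℝ, Complex.measurableEquivRealProd.symm (t, u) = ⟨t, u⟩ := fun t => rfl
  simp only [e2]
  rw [lintegral_mul_const' _ _ ENNReal.ofReal_ne_top]
  by_cases h : u ∈ Set.Ioo (-(π / 2)) (π / 2)
  · rw [Set.indicator_of_mem h]; rfl
  · rw [Set.indicator_of_notMem h]
    have : ∀ t : ℝ, hh f ⟨t, u⟩ = 0 := fun t => Set.indicator_of_notMem (s := strip) h _
    simp [this]

lemma refl_int (G : ℝ → ENNReal) (b : ℝ) :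
    ∫⁻ u in Set.Ioo (-b) b, G (-u) = ∫⁻ u in Set.Ioo (-b) b, G u := by
  have := (Measure.measurePreserving_neg (volume : Measure ℝ)).setLIntegral_comp_preimage_emb
    (MeasurableEquiv.neg ℝ).measurableEmbedding G (Set.Ioo (-b) b)
  rw [← this]
  have e : Neg.neg ⁻¹' Set.Ioo (-b) b = Set.Ioo (-b) b := by ext x; simp [and_comm]
  rw [e]

lemma strip_ineq (f : ℂ → ℂ) (hf : DifferentiableOn ℂ f strip) {α β : ℝ} (hα : -1 < α) (hβ : α < β)
    (hfin : ∫⁻ ζ in strip, ENNReal.ofReal (‖f ζ‖ ^ 2 * Real.cos ζ.im ^ α) ≠ ⊤) :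
    (∫⁻ ζ in strip, ENNReal.ofReal (‖f ζ‖ ^ 2 * Real.cos ζ.im ^ β)) * ENNReal.ofReal (cosI α) ≤
     (∫⁻ ζ in strip, ENNReal.ofReal (‖f ζ‖ ^ 2 * Real.cos ζ.im ^ α)) * ENNReal.ofReal (cosI β) := by
  rw [strip_iter f hf] at hfin ⊢
  rw [strip_iter f hf]
  set I := Set.Ioo (-(π / 2)) (π / 2) with hI
  have hMm := measurable_MM f hf
  set N : ℝ → ENNReal := fun u => MM f u + MM f (-u) with hN
  have hNm : Measurable N := hMm.add (hMm.comp measurable_neg)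
  have hwm : ∀ a : ℝ, Measurable (fun u : ℝ => ENNReal.ofReal (Real.cos u ^ a)) := by
    intro a; fun_prop
  have hNS : ∀ a : ℝ, ∫⁻ u in I, N u * ENNReal.ofReal (Real.cos u ^ a) =
      2 * ∫⁻ u in I, MM f u * ENNReal.ofReal (Real.cos u ^ a) := by
    intro a
    have := refl_int (fun u => MM f u * ENNReal.ofReal (Real.cos u ^ a)) (π / 2)
    simp only [hN, add_mul]
    have h1 : Measurable (fun u => MM f u * ENNReal.ofReal (Real.cos u ^ a)) := hMm.mul (hwm a)
    rw [lintegral_add_left h1]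
    simp only [Real.cos_neg] at this
    rw [this, two_mul]
  have hNfin : ∫⁻ u in I, N u * ENNReal.ofReal (Real.cos u ^ α) ≠ ⊤ := by
    rw [hNS]; exact ENNReal.mul_ne_top (by simp) hfin
  have hloc : ∀ a < π / 2, ∫⁻ u in Set.Ioo (-a) a, N u < ⊤ := by
    intro a ha
    rcases le_or_gt a 0 with h0 | h0
    · rw [Set.Ioo_eq_empty (by linarith)]; simp
    have hca : 0 < Real.cos a := Real.cos_pos_of_mem_Ioo ⟨by linarith, ha⟩
    set k := min 1 (Real.cos a ^ α) with hk
    have hk0 : 0 < k := lt_min one_pos (by positivity)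
    have hle : ∀ u ∈ Set.Ioo (-a) a, k ≤ Real.cos u ^ α := by
      intro u hu
      have hcu : Real.cos a ≤ Real.cos u := by
        rw [← Real.cos_abs u]
        exact Real.cos_le_cos_of_nonneg_of_le_pi (abs_nonneg u) (by linarith) (abs_lt.2 hu).le
      rcases le_or_gt 0 α with h | h
      · exact (min_le_right _ _).trans (Real.rpow_le_rpow hca.le hcu h)
      · exact (min_le_left _ _).trans
          (Real.one_le_rpow_of_pos_of_le_one_of_nonpos (hca.trans_le hcu) (Real.cos_le_one u) h.le)
    have h1 : (∫⁻ u in Set.Ioo (-a) a, N u) * ENNReal.ofReal k ≤ ∫⁻ u in I, N u * ENNReal.ofReal (Real.cos u ^ α) := by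
      rw [← lintegral_mul_const' _ _ ENNReal.ofReal_ne_top]
      refine (setLIntegral_mono' measurableSet_Ioo (fun u hu => ?_)).trans
        (lintegral_mono_set (Set.Ioo_subset_Ioo (by linarith) (by linarith)))
      gcongr
      exact hle u hu
    by_contra htop
    rw [not_lt, top_le_iff] at htop
    rw [htop, ENNReal.top_mul (by simpa using hk0)] at h1
    exact hNfin (top_le_iff.1 h1)
  obtain ⟨E, hE, hmono⟩ := ae_mono N hNm (fun u => by simp [hN, add_comm]) (π / 2) hloc (by
    intro u r hr hur
    simp only [hN, mul_add, neg_add]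
    have h1 : Measurable (fun θ => MM f (u + r * Real.sin θ)) := hMm.comp (by fun_prop)
    rw [lintegral_add_left h1]
    refine add_le_add (MM_sub f hf u r (by rwa [abs_of_nonneg hr])) ?_
    have := MM_sub f hf (-u) (-r) (by rwa [abs_neg, abs_neg, abs_of_nonneg hr])
    simpa only [neg_mul] using this)
  set μ : Measure ℝ := (volume.restrict I).withDensity (fun u => ENNReal.ofReal (Real.cos u ^ α)) with hμ
  have hInt : ∀ G : ℝ → ENNReal, Measurable G → ∫⁻ u, G u ∂μ = ∫⁻ u in I, G u * ENNReal.ofReal (Real.cos u ^ α) := by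
    intro G hG
    rw [hμ, lintegral_withDensity_eq_lintegral_mul _ (hwm α) hG]
    simp only [Pi.mul_apply, mul_comm]
  have huniv : μ Set.univ = ENNReal.ofReal (cosI α) := by
    rw [← lintegral_one, hInt _ measurable_const]
    simp only [one_mul]
    exact lintegral_cos hα
  have : IsFiniteMeasure μ := ⟨by rw [huniv]; exact ENNReal.ofReal_lt_top⟩
  have hac : ∀ P : ℝ → Prop, (∀ᵐ u, u ∈ I → P u) → ∀ᵐ u ∂μ, P u := by
    intro P hP
    exact (withDensity_absolutelyContinuous _ _).ae_le ((ae_restrict_iff' measurableSet_Ioo).2 hP)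
  set p : ℝ → ENNReal := fun u => ENNReal.ofReal (Real.cos u ^ (β - α)) with hp
  have hpw : ∀ u ∈ I, p u * ENNReal.ofReal (Real.cos u ^ α) = ENNReal.ofReal (Real.cos u ^ β) := by
    intro u hu
    have hc := Real.cos_pos_of_mem_Ioo hu
    rw [hp, ← ENNReal.ofReal_mul (by positivity), ← Real.rpow_add hc]
    congr 2; ring
  have key := chebyshev_enn μ N p hNm (hwm _) (by rwa [hInt N hNm]) (E ∩ I)
    (hac _ (by filter_upwards [hE] with u hu h using ⟨hu h, h⟩))
    (hac _ (ae_of_all _ fun u hu => by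
      have hc := Real.cos_pos_of_mem_Ioo hu
      rw [hp]
      simp only [ENNReal.ofReal_le_one]
      exact Real.rpow_le_one hc.le (Real.cos_le_one u) (by linarith))) (by
      have hpm : ∀ u ∈ I, ∀ v ∈ I, |u| ≤ |v| → (p v).toReal ≤ (p u).toReal := by
        intro u hu v hv huv
        have hcu := Real.cos_pos_of_mem_Ioo hu
        have hcv := Real.cos_pos_of_mem_Ioo hv
        simp only [hp]
        rw [ENNReal.toReal_ofReal (by positivity), ENNReal.toReal_ofReal (by positivity)]
        refine Real.rpow_le_rpow hcv.le ?_ (by linarith)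
        rw [← Real.cos_abs u, ← Real.cos_abs v]
        exact Real.cos_le_cos_of_nonneg_of_le_pi (abs_nonneg u) (by
          have := abs_lt.2 hv
          linarith [Real.pi_pos]) huv
      intro u hu v hv
      rcases le_total |u| |v| with h | h
      · have h1 := hmono u hu.1 v hv.1 h
        have h2 := hpm u hu.2 v hv.2 h
        exact mul_nonpos_of_nonpos_of_nonneg (by linarith) (by linarith)
      · have h1 := hmono v hv.1 u hu.1 h
        have h2 := hpm v hv.2 u hu.2 h
        exact mul_nonpos_of_nonneg_of_nonpos (by linarith) (by linarith))
  have hNp : Measurable (fun u => N u * p u) := hNm.mul (hwm _)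
  rw [hInt _ hNp, hInt _ hNm, hInt _ (hwm _), huniv] at key
  rw [setLIntegral_congr_fun measurableSet_Ioo hpw, lintegral_cos (hα.trans hβ)] at key
  have e : ∫⁻ u in I, N u * p u * ENNReal.ofReal (Real.cos u ^ α) = ∫⁻ u in I, N u * ENNReal.ofReal (Real.cos u ^ β) := by
    apply setLIntegral_congr_fun measurableSet_Ioo
    intro u hu
    simp only
    rw [mul_assoc, hpw u hu]
  rw [e, hNS, hNS, mul_assoc, mul_assoc] at key
  exact (ENNReal.mul_le_mul_iff_right (by simp) (by simp)).1 key

/-- conformal map from the strip onto the disk -/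
noncomputable def TT (ζ : ℂ) : ℂ := (Complex.exp ζ - 1) / (Complex.exp ζ + 1)

lemma exp_re_pos {ζ : ℂ} (h : ζ ∈ strip) : 0 < (Complex.exp ζ).re := by
  rw [Complex.exp_re]
  exact mul_pos (Real.exp_pos _) (Real.cos_pos_of_mem_Ioo h)

lemma exp_add_one_ne {ζ : ℂ} (h : ζ ∈ strip) : Complex.exp ζ + 1 ≠ 0 := by
  intro h0
  have h1 := congrArg Complex.re h0
  have := exp_re_pos h
  simp only [Complex.add_re, Complex.one_re, Complex.zero_re] at h1
  linarith

lemma one_sub_TT {ζ : ℂ} (h : ζ ∈ strip) : 1 - TT ζ ^ 2 = 4 * Complex.exp ζ / (Complex.exp ζ + 1) ^ 2 := by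
  have := exp_add_one_ne h
  rw [TT]
  field_simp
  ring

lemma cayley_TT {ζ : ℂ} (h : ζ ∈ strip) : (1 + TT ζ) / (1 - TT ζ) = Complex.exp ζ := by
  have := exp_add_one_ne h
  have e1 : 1 + TT ζ = 2 * Complex.exp ζ / (Complex.exp ζ + 1) := by rw [TT]; field_simp; ring
  have e2 : 1 - TT ζ = 2 / (Complex.exp ζ + 1) := by rw [TT]; field_simp; ring
  rw [e1, e2]; field_simp

lemma log_TT {ζ : ℂ} (h : ζ ∈ strip) : Complex.log ((1 + TT ζ) / (1 - TT ζ)) = ζ := by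
  rw [cayley_TT h, Complex.log_exp]
  · linarith [h.1, Real.pi_pos]
  · linarith [h.2, Real.pi_pos]

lemma norm_TT {ζ : ℂ} (h : ζ ∈ strip) : 1 - ‖TT ζ‖ ^ 2 = Real.cos ζ.im * ‖1 - TT ζ ^ 2‖ := by
  have h0 := exp_add_one_ne h
  have h1 : 0 < ‖Complex.exp ζ + 1‖ := norm_pos_iff.2 h0
  have h2 : ‖Complex.exp ζ + 1‖ ^ 2 - ‖Complex.exp ζ - 1‖ ^ 2 = 4 * (Complex.exp ζ).re := by
    rw [← Complex.normSq_eq_norm_sq, ← Complex.normSq_eq_norm_sq, Complex.normSq_apply, Complex.normSq_apply]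
    simp; ring
  rw [one_sub_TT h, TT, norm_div, norm_div, norm_mul, norm_pow, Complex.norm_exp]
  rw [Complex.exp_re] at h2
  simp only [RCLike.norm_ofNat]
  field_simp
  linarith

lemma one_sub_TT_ne {ζ : ℂ} (h : ζ ∈ strip) : 1 - TT ζ ^ 2 ≠ 0 := by
  rw [one_sub_TT h]
  exact div_ne_zero (mul_ne_zero (by norm_num) (Complex.exp_ne_zero _)) (pow_ne_zero _ (exp_add_one_ne h))

lemma TT_mem {ζ : ℂ} (h : ζ ∈ strip) : TT ζ ∈ Metric.ball (0 : ℂ) 1 := by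
  have h1 := norm_TT h
  have h2 : 0 < Real.cos ζ.im * ‖1 - TT ζ ^ 2‖ :=
    mul_pos (Real.cos_pos_of_mem_Ioo h) (norm_pos_iff.2 (one_sub_TT_ne h))
  rw [mem_ball_zero_iff]
  nlinarith [norm_nonneg (TT ζ)]

lemma hasDerivAt_TT {ζ : ℂ} (h : ζ ∈ strip) : HasDerivAt TT ((1 - TT ζ ^ 2) / 2) ζ := by
  have h0 := exp_add_one_ne h
  have := ((Complex.hasDerivAt_exp ζ).sub_const 1).div ((Complex.hasDerivAt_exp ζ).add_const 1) h0
  convert! this using 1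
  rw [one_sub_TT h]
  field_simp
  ring

lemma injOn_TT : Set.InjOn TT strip := by
  intro x hx y hy h
  rw [← log_TT hx, ← log_TT hy, h]

lemma cayley_re_pos {z : ℂ} (hz : z ∈ Metric.ball (0 : ℂ) 1) : 0 < ((1 + z) / (1 - z)).re := by
  rw [mem_ball_zero_iff] at hz
  have h1 : 1 - z ≠ 0 := by
    intro h
    have : z = 1 := by linear_combination -h
    rw [this] at hz; simp at hz
  have h2 : 0 < Complex.normSq (1 - z) := Complex.normSq_pos.2 h1
  have h3 : ‖z‖ ^ 2 < 1 := by nlinarith [norm_nonneg z]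
  rw [← Complex.normSq_eq_norm_sq, Complex.normSq_apply] at h3
  rw [Complex.div_re, ← add_div]
  apply div_pos _ h2
  simp
  nlinarith

lemma one_sub_ne {z : ℂ} (hz : z ∈ Metric.ball (0 : ℂ) 1) : 1 - z ≠ 0 := by
  intro h
  rw [mem_ball_zero_iff] at hz
  have : z = 1 := by linear_combination -h
  rw [this] at hz; simp at hz

lemma one_sub_sq_slit {z : ℂ} (hz : z ∈ Metric.ball (0 : ℂ) 1) : 1 - z ^ 2 ∈ Complex.slitPlane := by
  left
  rw [mem_ball_zero_iff] at hz
  have h1 : (z ^ 2).re ≤ ‖z ^ 2‖ := Complex.re_le_norm _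
  rw [norm_pow] at h1
  have : ‖z‖ ^ 2 < 1 := by nlinarith [norm_nonneg z]
  simp only [Complex.sub_re, Complex.one_re]
  linarith

lemma image_TT : TT '' strip = Metric.ball (0 : ℂ) 1 := by
  ext z
  constructor
  · rintro ⟨ζ, h, rfl⟩; exact TT_mem h
  · intro hz
    have h1 := cayley_re_pos hz
    have h0 : (1 + z) / (1 - z) ≠ 0 := by
      intro h; rw [h] at h1; simp at h1
    refine ⟨Complex.log ((1 + z) / (1 - z)), ?_, ?_⟩
    · have := Complex.abs_arg_lt_pi_div_two_iff.2 (Or.inl h1)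
      rw [← Complex.log_im] at this
      exact abs_lt.1 this
    · have := one_sub_ne hz
      rw [TT, Complex.exp_log h0]
      have e1 : (1 + z) / (1 - z) - 1 = 2 * z / (1 - z) := by field_simp; ring
      have e2 : (1 + z) / (1 - z) + 1 = 2 / (1 - z) := by field_simp; ring
      rw [e1, e2]; field_simp

lemma disk_to_strip (G : ℂ → ENNReal) :
    ∫⁻ z in Metric.ball (0 : ℂ) 1, G z =
      ∫⁻ ζ in strip, ENNReal.ofReal (‖1 - TT ζ ^ 2‖ ^ 2 / 4) * G (TT ζ) := by
  rw [← image_TT, lintegral_image_eq_lintegral_abs_det_fderiv_mul volume isOpen_strip.measurableSet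
    (fun ζ h => ((hasDerivAt_TT h).hasFDerivAt.restrictScalars ℝ).hasFDerivWithinAt) injOn_TT]
  congr 1; ext ζ
  congr 2
  simp [ContinuousLinearMap.det, LinearMap.det_restrictScalars, Algebra.norm_complex_eq,
    Complex.normSq_eq_norm_sq]
  norm_num
  positivity

/-- the transplanted function -/
noncomputable def FF (α : ℝ) (φ : ℂ → ℂ) (ζ : ℂ) : ℂ := φ (TT ζ) * (1 - TT ζ ^ 2) ^ (((α + 2) / 2 : ℝ) : ℂ)

lemma FF_diff (α : ℝ) (φ : ℂ → ℂ) (hφ : DifferentiableOn ℂ φ (Metric.ball 0 1)) :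
    DifferentiableOn ℂ (FF α φ) strip := by
  have hT : DifferentiableOn ℂ TT strip := fun ζ h => (hasDerivAt_TT h).differentiableAt.differentiableWithinAt
  apply DifferentiableOn.mul
  · exact hφ.comp hT (fun ζ h => TT_mem h)
  · apply DifferentiableOn.cpow_const
    · fun_prop
    · intro ζ h; exact one_sub_sq_slit (TT_mem h)

lemma transplant (α β : ℝ) (φ : ℂ → ℂ) :
    ∫⁻ z in Metric.ball (0 : ℂ) 1, ENNReal.ofReal (‖(1 - z ^ 2) ^ (-(((β - α) / 2 : ℝ) : ℂ)) * φ z‖ ^ 2 * (1 - ‖z‖ ^ 2) ^ β) =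
     ENNReal.ofReal (1 / 4) * ∫⁻ ζ in strip, ENNReal.ofReal (‖FF α φ ζ‖ ^ 2 * Real.cos ζ.im ^ β) := by
  rw [disk_to_strip, ← lintegral_const_mul' _ _ ENNReal.ofReal_ne_top]
  apply setLIntegral_congr_fun isOpen_strip.measurableSet
  intro ζ h
  simp only
  rw [← ENNReal.ofReal_mul (by positivity), ← ENNReal.ofReal_mul (by positivity)]
  congr 1
  have hX : 0 < ‖1 - TT ζ ^ 2‖ := norm_pos_iff.2 (one_sub_TT_ne h)
  have hc : 0 < Real.cos ζ.im := Real.cos_pos_of_mem_Ioo h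
  rw [FF, norm_TT h, norm_mul, norm_mul, Complex.norm_cpow_real, ← Complex.ofReal_neg, Complex.norm_cpow_real,
    Real.mul_rpow hc.le hX.le]
  set X := ‖1 - TT ζ ^ 2‖
  have e1 : (X ^ (-((β - α) / 2))) ^ 2 = X ^ (α - β) := by
    rw [← Real.rpow_natCast, ← Real.rpow_mul hX.le]; congr 1; push_cast; ring
  have e2 : (X ^ ((α + 2) / 2)) ^ 2 = X ^ (α + 2) := by
    rw [← Real.rpow_natCast, ← Real.rpow_mul hX.le]; congr 1; push_cast; ring
  have e3 : X ^ (α + 2) = X ^ 2 * X ^ (α - β) * X ^ β := by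
    rw [← Real.rpow_natCast, ← Real.rpow_add hX, ← Real.rpow_add hX]; congr 1; push_cast; ring
  rw [mul_pow, mul_pow, e1, e2, e3]
  ring

lemma norm_eq (a : ℝ) (ψ : ℂ → ℂ) (hψ : ContinuousOn ψ (Metric.ball 0 1)) :
    AEStronglyMeasurable (fun z : ℂ => ‖ψ z‖ ^ 2 * (1 - ‖z‖ ^ 2) ^ a) (volume.restrict (Metric.ball 0 1)) ∧
    (∀ z ∈ Metric.ball (0:ℂ) 1, 0 ≤ ‖ψ z‖ ^ 2 * (1 - ‖z‖ ^ 2) ^ a) ∧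
    bergmanNormSq a ψ = (a + 1) / π *
      (∫⁻ z in Metric.ball (0 : ℂ) 1, ENNReal.ofReal (‖ψ z‖ ^ 2 * (1 - ‖z‖ ^ 2) ^ a)).toReal := by
  have h2 : ∀ z ∈ Metric.ball (0:ℂ) 1, 0 < 1 - ‖z‖ ^ 2 := by
    intro z hz
    rw [mem_ball_zero_iff] at hz
    nlinarith [norm_nonneg z]
  have h1 : AEStronglyMeasurable (fun z : ℂ => ‖ψ z‖ ^ 2 * (1 - ‖z‖ ^ 2) ^ a) (volume.restrict (Metric.ball 0 1)) := by
    apply ContinuousOn.aestronglyMeasurable _ measurableSet_ball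
    apply ContinuousOn.mul (hψ.norm.pow 2)
    apply ContinuousOn.rpow_const
    · fun_prop
    · intro z hz; exact Or.inl (h2 z hz).ne'
  have h3 : ∀ z ∈ Metric.ball (0:ℂ) 1, 0 ≤ ‖ψ z‖ ^ 2 * (1 - ‖z‖ ^ 2) ^ a := fun z hz =>
    mul_nonneg (by positivity) (Real.rpow_nonneg (h2 z hz).le _)
  refine ⟨h1, h3, ?_⟩
  rw [bergmanNormSq, integral_eq_lintegral_of_nonneg_ae _ h1]
  filter_upwards [ae_restrict_mem measurableSet_ball] with z hz using h3 z hz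

lemma transplant_self (α : ℝ) (φ : ℂ → ℂ) :
    ∫⁻ z in Metric.ball (0 : ℂ) 1, ENNReal.ofReal (‖φ z‖ ^ 2 * (1 - ‖z‖ ^ 2) ^ α) =
     ENNReal.ofReal (1 / 4) * ∫⁻ ζ in strip, ENNReal.ofReal (‖FF α φ ζ‖ ^ 2 * Real.cos ζ.im ^ α) := by
  rw [← transplant]
  simp

lemma g_cont (s : ℂ) : DifferentiableOn ℂ (fun z : ℂ => (1 - z ^ 2) ^ s) (Metric.ball 0 1) := by
  apply DifferentiableOn.cpow_const
  · fun_prop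
  · intro z hz; exact one_sub_sq_slit hz

/-- test functions -/
noncomputable def testφ (α ε : ℝ) (z : ℂ) : ℂ :=
  Complex.exp (-ε * Complex.log ((1 + z) / (1 - z)) ^ 2) * (1 - z ^ 2) ^ (-(((α + 2) / 2 : ℝ) : ℂ))

lemma testφ_diff (α ε : ℝ) : DifferentiableOn ℂ (testφ α ε) (Metric.ball 0 1) := by
  apply DifferentiableOn.mul _ (g_cont _)
  have h1 : DifferentiableOn ℂ (fun z : ℂ => (1 + z) / (1 - z)) (Metric.ball 0 1) :=
    DifferentiableOn.div (by fun_prop) (by fun_prop) (fun z hz => one_sub_ne hz)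
  have h2 := h1.clog (fun z hz => Or.inl (cayley_re_pos hz))
  exact ((h2.pow 2).const_mul (-(ε:ℂ))).cexp

lemma FF_test (α ε : ℝ) {ζ : ℂ} (h : ζ ∈ strip) :
    ‖FF α (testφ α ε) ζ‖ ^ 2 = Real.exp (-(2 * ε) * ζ.re ^ 2) * Real.exp (2 * ε * ζ.im ^ 2) := by
  have h0 := one_sub_TT_ne h
  rw [FF, testφ, log_TT h, mul_assoc, ← Complex.cpow_add _ _ h0, neg_add_cancel, Complex.cpow_zero, mul_one,
    Complex.norm_exp, ← Real.exp_nat_mul, ← Real.exp_add]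
  congr 1
  simp [pow_two]
  ring

lemma MM_test (α ε : ℝ) {u : ℝ} (h : u ∈ Set.Ioo (-(π / 2)) (π / 2)) :
    MM (FF α (testφ α ε)) u =
      (∫⁻ t : ℝ, ENNReal.ofReal (Real.exp (-(2 * ε) * t ^ 2))) * ENNReal.ofReal (Real.exp (2 * ε * u ^ 2)) := by
  rw [MM, ← lintegral_mul_const' _ _ ENNReal.ofReal_ne_top]
  congr 1; ext t
  rw [hh, Set.indicator_of_mem (s := strip) h, FF_test α ε (ζ := ⟨t, u⟩) h, ENNReal.ofReal_mul (by positivity)]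

lemma gauss (ε : ℝ) (hε : 0 < ε) : ∃ G : ℝ, 0 < G ∧
    ∫⁻ t : ℝ, ENNReal.ofReal (Real.exp (-(2 * ε) * t ^ 2)) = ENNReal.ofReal G := by
  refine ⟨√(π / (2 * ε)), by positivity, ?_⟩
  rw [← integral_gaussian, ofReal_integral_eq_lintegral_ofReal (integrable_exp_neg_mul_sq (by positivity))
    (ae_of_all _ fun t => by positivity)]

lemma test_bounds (α ε : ℝ) (hε : 0 < ε) : ∃ G : ℝ, 0 < G ∧ ∀ a : ℝ, -1 < a →
    ENNReal.ofReal (G * cosI a) ≤ ∫⁻ ζ in strip, ENNReal.ofReal (‖FF α (testφ α ε) ζ‖ ^ 2 * Real.cos ζ.im ^ a) ∧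
    ∫⁻ ζ in strip, ENNReal.ofReal (‖FF α (testφ α ε) ζ‖ ^ 2 * Real.cos ζ.im ^ a) ≤
      ENNReal.ofReal (Real.exp (2 * ε * (π / 2) ^ 2) * (G * cosI a)) := by
  obtain ⟨G, hG, hGe⟩ := gauss ε hε
  refine ⟨G, hG, fun a ha => ?_⟩
  rw [strip_iter _ (FF_diff _ _ (testφ_diff α ε))]
  rw [ENNReal.ofReal_mul (Real.exp_pos _).le, ENNReal.ofReal_mul hG.le, ← lintegral_cos ha,
    ← lintegral_const_mul' _ _ ENNReal.ofReal_ne_top, ← lintegral_const_mul' _ _ ENNReal.ofReal_ne_top]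
  constructor
  · apply setLIntegral_mono' measurableSet_Ioo
    intro u hu
    rw [MM_test α ε hu, hGe]
    gcongr
    have : 1 ≤ ENNReal.ofReal (Real.exp (2 * ε * u ^ 2)) := by
      rw [ENNReal.one_le_ofReal]
      exact Real.one_le_exp (by positivity)
    calc ENNReal.ofReal G = ENNReal.ofReal G * 1 := (mul_one _).symm
      _ ≤ _ := by gcongr
  · apply setLIntegral_mono' measurableSet_Ioo
    intro u hu
    rw [MM_test α ε hu, hGe, ← mul_assoc, mul_comm (ENNReal.ofReal G)]
    gcongr ENNReal.ofReal (Real.exp (_ * ?_)) * _ * _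
    exact sq_le_sq' hu.1.le hu.2.le

theorem multiplier_norm_g0 (α β : ℝ) (hα : -1 < α) (hβ : α < β) :
    multNormSq α β (fun z : ℂ => (1 - z ^ 2) ^ (-(((β - α) / 2 : ℝ) : ℂ))) =
      2 ^ (α - β) * (Real.Gamma (β + 2) / Real.Gamma (α + 2)) *
        (Real.Gamma (1 + α / 2) / Real.Gamma (1 + β / 2)) ^ 2 := by
  rw [← cos_const hα hβ]
  have hcα := cosI_pos hα
  have hcβ := cosI_pos (hα.trans hβ)
  have hα1 : 0 < α + 1 := by linarith
  have hβ1 : 0 < β + 1 := by linarith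
  have hpi := Real.pi_pos
  set C := (β + 1) / (α + 1) * (cosI β / cosI α) with hC
  have hC0 : 0 < C := by positivity
  set S : (ℂ → ℂ) → ℝ → ENNReal := fun φ a =>
    ∫⁻ ζ in strip, ENNReal.ofReal (‖FF α φ ζ‖ ^ 2 * Real.cos ζ.im ^ a) with hS
  have hnα : ∀ φ : ℂ → ℂ, DifferentiableOn ℂ φ (Metric.ball 0 1) →
      bergmanNormSq α φ = (α + 1) / π * (1 / 4 * (S φ α).toReal) := by
    intro φ hφ
    rw [(norm_eq α φ hφ.continuousOn).2.2, transplant_self, ENNReal.toReal_mul, ENNReal.toReal_ofReal (by norm_num)]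
  have hnβ : ∀ φ : ℂ → ℂ, DifferentiableOn ℂ φ (Metric.ball 0 1) →
      bergmanNormSq β (fun z => (1 - z ^ 2) ^ (-(((β - α) / 2 : ℝ) : ℂ)) * φ z) =
        (β + 1) / π * (1 / 4 * (S φ β).toReal) := by
    intro φ hφ
    have hc : ContinuousOn (fun z : ℂ => (1 - z ^ 2) ^ (-(((β - α) / 2 : ℝ) : ℂ)) * φ z)
        (Metric.ball 0 1) := ((g_cont _).mul hφ).continuousOn
    rw [(norm_eq β _ hc).2.2, transplant, ENNReal.toReal_mul,
      ENNReal.toReal_ofReal (by norm_num)]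
  have hmem : ∀ φ : ℂ → ℂ, DifferentiableOn ℂ φ (Metric.ball 0 1) →
      (MemBergman α φ ↔ S φ α ≠ ⊤) := by
    intro φ hφ
    obtain ⟨h1, h2, -⟩ := norm_eq α φ hφ.continuousOn
    have h3 := hasFiniteIntegral_iff_ofReal (μ := volume.restrict (Metric.ball (0:ℂ) 1))
      (f := fun z : ℂ => ‖φ z‖ ^ 2 * (1 - ‖z‖ ^ 2) ^ α)
      (by filter_upwards [ae_restrict_mem measurableSet_ball] with z hz using h2 z hz)
    rw [transplant_self] at h3
    have h4 : ENNReal.ofReal (1 / 4) * S φ α < ⊤ ↔ S φ α ≠ ⊤ := by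
      constructor
      · intro h ht
        rw [ht, ENNReal.mul_top (by norm_num)] at h
        exact lt_irrefl _ h
      · intro h; exact ENNReal.mul_lt_top ENNReal.ofReal_lt_top h.lt_top
    constructor
    · rintro ⟨-, h⟩
      exact h4.1 (h3.1 h.2)
    · intro h
      exact ⟨hφ, h1, h3.2 (h4.2 h)⟩
  have htest : ∀ ε > 0, ∃ t ∈ {t : ℝ | ∃ φ : ℂ → ℂ, MemBergman α φ ∧ bergmanNormSq α φ ≠ 0 ∧
      t = bergmanNormSq β (fun z => (1 - z ^ 2) ^ (-(((β - α) / 2 : ℝ) : ℂ)) * φ z) / bergmanNormSq α φ},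
      C / Real.exp (2 * ε * (π / 2) ^ 2) ≤ t := by
    intro ε hε
    obtain ⟨G, hG, hb⟩ := test_bounds α ε hε
    have hd := testφ_diff α ε
    have ba := hb α hα
    have bb := hb β (hα.trans hβ)
    change ENNReal.ofReal (G * cosI α) ≤ S (testφ α ε) α ∧ S (testφ α ε) α ≤ _ at ba
    change ENNReal.ofReal (G * cosI β) ≤ S (testφ α ε) β ∧ S (testφ α ε) β ≤ _ at bb
    have fa : S (testφ α ε) α ≠ ⊤ := (ba.2.trans_lt ENNReal.ofReal_lt_top).ne
    have fb : S (testφ α ε) β ≠ ⊤ := (bb.2.trans_lt ENNReal.ofReal_lt_top).ne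
    have ra1 := (ENNReal.ofReal_le_iff_le_toReal fa).1 ba.1
    have rb1 := (ENNReal.ofReal_le_iff_le_toReal fb).1 bb.1
    have ra2 := ENNReal.toReal_le_of_le_ofReal (by positivity) ba.2
    have hpos : 0 < (S (testφ α ε) α).toReal := lt_of_lt_of_le (by positivity) ra1
    refine ⟨_, ⟨testφ α ε, (hmem _ hd).2 fa, ?_, rfl⟩, ?_⟩
    · rw [hnα _ hd]; positivity
    · rw [hnα _ hd, hnβ _ hd]
      set A := (S (testφ α ε) α).toReal
      set B := (S (testφ α ε) β).toReal
      set K := Real.exp (2 * ε * (π / 2) ^ 2)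
      have hK : 0 < K := Real.exp_pos _
      calc C / K = (β + 1) / (α + 1) * (G * cosI β) / (K * (G * cosI α)) := by rw [hC]; field_simp
        _ ≤ (β + 1) / (α + 1) * B / A := by gcongr
        _ = _ := by field_simp
  unfold multNormSq
  apply csSup_eq_of_forall_le_of_forall_lt_exists_gt
  · obtain ⟨t, ht, -⟩ := htest 1 one_pos
    exact ⟨t, ht⟩
  · rintro t ⟨φ, hφ, hne, rfl⟩
    have hd := hφ.1
    have fa := (hmem φ hd).1 hφ
    have key := strip_ineq (FF α φ) (FF_diff α φ hd) hα hβ fa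
    change S φ β * ENNReal.ofReal (cosI α) ≤ S φ α * ENNReal.ofReal (cosI β) at key
    have key2 := ENNReal.toReal_mono (ENNReal.mul_ne_top fa ENNReal.ofReal_ne_top) key
    rw [ENNReal.toReal_mul, ENNReal.toReal_mul, ENNReal.toReal_ofReal hcα.le, ENNReal.toReal_ofReal hcβ.le] at key2
    rw [hnα φ hd] at hne
    rw [hnα φ hd, hnβ φ hd]
    have hA : 0 < (S φ α).toReal := by
      refine lt_of_le_of_ne ENNReal.toReal_nonneg (fun h => hne ?_)
      rw [← h]; ring
    set A := (S φ α).toReal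
    set B := (S φ β).toReal
    rw [div_le_iff₀ (by positivity)]
    have hB : B ≤ A * cosI β / cosI α := by rwa [le_div_iff₀ hcα]
    calc (β + 1) / π * (1 / 4 * B) ≤ (β + 1) / π * (1 / 4 * (A * cosI β / cosI α)) := by gcongr
      _ = _ := by rw [hC]; field_simp
  · intro w hw
    have hlim : Filter.Tendsto (fun ε : ℝ => C / Real.exp (2 * ε * (π / 2) ^ 2)) (nhdsWithin 0 (Set.Ioi 0)) (nhds C) := by
      have hcont : Continuous (fun ε : ℝ => C / Real.exp (2 * ε * (π / 2) ^ 2)) :=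
        continuous_const.div (by fun_prop) (fun ε => (Real.exp_pos _).ne')
      have := (hcont.tendsto 0).mono_left (nhdsWithin_le_nhds (s := Set.Ioi 0))
      simpa using this
    obtain ⟨ε, h1, h2⟩ := ((hlim.eventually (lt_mem_nhds hw)).and self_mem_nhdsWithin).exists
    obtain ⟨t, ht, hle⟩ := htest ε h2
    exact ⟨t, ht, h1.trans_le hle⟩
end

section
/- Let α > -1, β > α. For every analytic φ ∈ A²_α(Δ): (β+1)/π ∬_Δ (1-|z|²)^β |1-z²|^{-(β-α)} |φ(z)|² dxdy ≤ 2^{α-β} (Γ(β+2)/Γ(α+2)) (Γ(1+α/2)/Γ(1+β/2))² · (α+1)/π ∬_Δ |φ(z)|²(1-|z|²)^α dxdy. -/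
open MeasureTheory Complex Real
open Set
open scoped ENNReal

lemma aux_area_mean (G : ℂ → ℂ) (hG : Measurable G) (c : ℂ) (δ : ℝ)
    (hd : DifferentiableOn ℂ G (Metric.ball c δ)) :
    ‖G c‖ₑ * volume (Metric.ball (0:ℂ) δ) ≤ ∫⁻ v in Metric.ball (0:ℂ) δ, ‖G (c + v)‖ₑ := by
  have key : ∀ v ∈ Metric.ball (0:ℂ) δ, ‖G c‖ₑ ≤
      ‖((2 * π)⁻¹ : ℝ)‖ₑ * ∫⁻ θ in Ioc 0 (2*π), ‖G (c + circleMap 0 1 θ * v)‖ₑ := by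
    intro v hv
    have hv' : ‖v‖ < δ := by simpa using hv
    have h1 : DiffContOnCl ℂ (fun u : ℂ => G (c + u * v)) (Metric.ball 0 |1|) := by
      apply DifferentiableOn.diffContOnCl
      rw [abs_one, closure_ball _ one_ne_zero]
      refine DifferentiableOn.comp hd (by fun_prop) ?_
      intro u hu
      have hu' : ‖u‖ ≤ 1 := by simpa using hu
      simp only [Metric.mem_ball, dist_self_add_left, norm_mul]
      nlinarith [norm_nonneg v]
    have h2 := h1.circleAverage
    simp only [zero_mul, add_zero] at h2
    rw [← h2, circleAverage_def, enorm_smul, intervalIntegral.integral_of_le (by positivity)]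
    gcongr
    exact enorm_integral_le_lintegral_enorm _
  have hm : Measurable (fun p : ℂ × ℝ => ‖G (c + circleMap 0 1 p.2 * p.1)‖ₑ) := by
    have : Continuous (fun p : ℂ × ℝ => c + circleMap 0 1 p.2 * p.1) := by
      unfold circleMap; fun_prop
    exact (hG.comp this.measurable).enorm
  calc ‖G c‖ₑ * volume (Metric.ball (0:ℂ) δ) = ∫⁻ v in Metric.ball (0:ℂ) δ, ‖G c‖ₑ := by
        rw [setLIntegral_const]
    _ ≤ ∫⁻ v in Metric.ball (0:ℂ) δ,
        ‖((2 * π)⁻¹ : ℝ)‖ₑ * ∫⁻ θ in Ioc 0 (2*π), ‖G (c + circleMap 0 1 θ * v)‖ₑ :=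
        setLIntegral_mono' measurableSet_ball key
    _ = ‖((2 * π)⁻¹ : ℝ)‖ₑ * ∫⁻ θ in Ioc 0 (2*π), ∫⁻ v in Metric.ball (0:ℂ) δ,
          ‖G (c + circleMap 0 1 θ * v)‖ₑ := by
        rw [lintegral_const_mul _ hm.lintegral_prod_right', lintegral_lintegral_swap hm.aemeasurable]
    _ = ‖((2 * π)⁻¹ : ℝ)‖ₑ * ∫⁻ θ in Ioc 0 (2*π), ∫⁻ v in Metric.ball (0:ℂ) δ, ‖G (c + v)‖ₑ := by
        congr 1
        apply lintegral_congr
        intro θ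
        have hn : ‖circleMap 0 1 θ‖ = 1 := by simp
        have hp := LinearIsometryEquiv.measurePreserving
          (rotation ⟨circleMap 0 1 θ, by simp [Submonoid.unitSphere]⟩)
        have := hp.setLIntegral_comp_preimage (measurableSet_ball (x := (0:ℂ)) (ε := δ))
          (f := fun v => ‖G (c + v)‖ₑ) (by fun_prop)
        rw [← this]
        have hpre : (rotation ⟨circleMap 0 1 θ, by simp [Submonoid.unitSphere]⟩) ⁻¹'
            Metric.ball (0:ℂ) δ = Metric.ball (0:ℂ) δ := by
          ext v
          simp
        rw [hpre]
        rfl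
    _ = ∫⁻ v in Metric.ball (0:ℂ) δ, ‖G (c + v)‖ₑ := by
        rw [setLIntegral_const, mul_comm (∫⁻ v in Metric.ball (0:ℂ) δ, ‖G (c + v)‖ₑ), ← mul_assoc]
        have : ‖((2 * π)⁻¹ : ℝ)‖ₑ * volume (Ioc 0 (2*π)) = 1 := by
          rw [Real.volume_Ioc, Real.enorm_eq_ofReal (by positivity), ← ENNReal.ofReal_mul (by positivity)]
          rw [sub_zero, inv_mul_cancel₀ (by positivity), ENNReal.ofReal_one]
        rw [this, one_mul]

lemma aux_bounded (G : ℂ → ℂ) (hG : Measurable G)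
    (hd : DifferentiableOn ℂ G {w | |w.re| < π/2})
    (hfin : ∀ y, y < π/2 → ∫⁻ w in {w : ℂ | |w.re| ≤ y}, ‖G w‖ₑ < ⊤) (y : ℝ) (hy : y < π/2) :
    ∃ B : ℝ, ∀ w : ℂ, |w.re| ≤ y → ‖G w‖ ≤ B := by
  set δ := (π/2 - y)/2 with hδ
  have hδ0 : 0 < δ := by rw [hδ]; linarith
  set V := volume (Metric.ball (0:ℂ) δ) with hV
  have hV0 : V ≠ 0 := (Metric.measure_ball_pos _ _ hδ0).ne'
  have hV1 : V ≠ ⊤ := measure_ball_lt_top.ne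
  set J := ∫⁻ w in {w : ℂ | |w.re| ≤ y + δ}, ‖G w‖ₑ with hJ
  have hJf : J < ⊤ := hfin _ (by rw [hδ]; linarith)
  refine ⟨(J / V).toReal, fun w hw => ?_⟩
  have hsub : Metric.ball w δ ⊆ {w : ℂ | |w.re| ≤ y + δ} := by
    intro v hv
    have h1 : ‖v - w‖ < δ := by simpa [dist_eq_norm] using hv
    have h2 := Complex.abs_re_le_norm (v - w)
    rw [Complex.sub_re] at h2
    have h3 := abs_sub_abs_le_abs_sub v.re w.re
    simp only [mem_ofPred_eq]
    linarith
  have h1 := aux_area_mean G hG w δ (hd.mono (hsub.trans (by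
    intro v hv
    simp only [mem_ofPred_eq] at hv ⊢
    linarith)))
  have h2 : ∫⁻ v in Metric.ball (0:ℂ) δ, ‖G (w + v)‖ₑ = ∫⁻ v in Metric.ball w δ, ‖G v‖ₑ := by
    have := (measurePreserving_add_left volume w).setLIntegral_comp_preimage
      (measurableSet_ball (x := w) (ε := δ)) (f := fun v => ‖G v‖ₑ) (by fun_prop)
    rw [← this]
    congr 2
    ext v; simp
  have h3 : ‖G w‖ₑ * V ≤ J := by
    rw [h2] at h1
    exact h1.trans (lintegral_mono_set hsub)
  have h4 : ‖G w‖ₑ ≤ J / V := (ENNReal.le_div_iff_mul_le (Or.inl hV0) (Or.inl hV1)).2 h3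
  have h5 := ENNReal.toReal_mono (ENNReal.div_lt_top hJf.ne hV0).ne h4
  simpa using h5

/-- vertical line integrals -/
noncomputable def auxM (G : ℂ → ℂ) (t : ℝ) : ℝ≥0∞ := ∫⁻ x : ℝ, ‖G (t + x * I)‖ₑ

lemma aux_three_lines (G : ℂ → ℂ) (hG : Measurable G)
    (hd : DifferentiableOn ℂ G {w | |w.re| < π/2})
    (hb : ∀ y, y < π/2 → ∃ B : ℝ, ∀ w : ℂ, |w.re| ≤ y → ‖G w‖ ≤ B)
    (y₀ y₁ : ℝ) (h01 : |y₀| < y₁) (h1 : y₁ < π/2) (s : ℝ) (hs : s = (y₀ + y₁)/(2*y₁)) :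
    auxM G y₀ ≤ ENNReal.ofReal (1 - s) * auxM G (-y₁) + ENNReal.ofReal s * auxM G y₁ := by
  obtain ⟨hl, hr⟩ := abs_lt.1 h01
  have hy1 : 0 < y₁ := (abs_nonneg _).trans_lt h01
  have hs0 : 0 < s := by rw [hs]; apply div_pos <;> linarith
  have hs1 : s < 1 := by rw [hs, div_lt_one (by linarith)]; linarith
  by_cases ha : auxM G (-y₁) = ⊤
  · rw [ha, ENNReal.mul_top (by simpa using hs1)]; simp
  by_cases hb' : auxM G y₁ = ⊤
  · rw [hb', ENNReal.mul_top (by simpa using hs0)]; simp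
  set a := (auxM G (-y₁)).toReal with hadef
  set b := (auxM G y₁).toReal with hbdef
  have hRHS : ENNReal.ofReal (1 - s) * auxM G (-y₁) + ENNReal.ofReal s * auxM G y₁
      = ENNReal.ofReal ((1-s) * a + s * b) := by
    rw [ENNReal.ofReal_add (by positivity [sub_pos.2 hs1]) (by positivity), ENNReal.ofReal_mul (by linarith),
      ENNReal.ofReal_mul hs0.le, ENNReal.ofReal_toReal ha, ENNReal.ofReal_toReal hb']
  rw [hRHS]
  have huniv : auxM G y₀ = ⨆ n : ℕ, ∫⁻ x in Ioc (-(n:ℝ)) n, ‖G (y₀ + x * I)‖ₑ := by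
    have hU : ⋃ n : ℕ, Ioc (-(n:ℝ)) n = univ := by
      refine eq_univ_of_forall fun x => mem_iUnion.2 ?_
      obtain ⟨n, hn⟩ := exists_nat_gt |x|
      exact ⟨n, (abs_lt.1 hn).1, (abs_lt.1 hn).2.le⟩
    rw [← setLIntegral_iUnion_of_directed, hU]
    · simp [auxM]
    · apply Monotone.directed_le
      intro i j hij
      have : (i:ℝ) ≤ j := by exact_mod_cast hij
      exact Ioc_subset_Ioc (by linarith) this
  rw [huniv]
  refine iSup_le fun n => ?_
  -- setup
  set μ := (volume : Measure ℝ).restrict (Ioc (-(n:ℝ)) n) with hμ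
  set u : ℝ → ℂ := fun x => (G (y₀ + x * I))⁻¹ * (‖G (y₀ + x * I)‖ : ℂ) with hu
  have hum : Measurable u := by
    have : Measurable fun x : ℝ => G (y₀ + x * I) := hG.comp (by fun_prop)
    fun_prop
  have hu1 : ∀ x, ‖u x‖ ≤ 1 := by
    intro x
    simp only [hu, norm_mul, norm_inv, Complex.norm_real, norm_norm]
    exact inv_mul_le_one
  have hGu : ∀ x : ℝ, G (y₀ + x * I) * u x = (‖G (y₀ + x * I)‖ : ℂ) := by
    intro x
    simp only [hu]
    by_cases h : G (y₀ + x * I) = 0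
    · simp [h]
    · rw [mul_inv_cancel_left₀ h]
  set h : ℂ → ℂ := fun w => ∫ x, G (w + x * I) * u x ∂μ with hh
  set y₂ := (y₁ + π/2)/2 with hy2
  obtain ⟨B, hB⟩ := hb y₂ (by rw [hy2]; linarith)
  have hB0 : 0 ≤ B := (norm_nonneg _).trans (hB 0 (by simp; rw [hy2]; positivity))
  have hshift : ∀ (w : ℂ) (x : ℝ), (w + x * I).re = w.re := by intro w x; simp
  have hmeas : ∀ w : ℂ, Measurable fun x : ℝ => G (w + x * I) * u x := by
    intro w
    exact (hG.comp (by fun_prop)).mul hum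
  have hbd : ∀ w : ℂ, |w.re| ≤ y₂ → ∀ x : ℝ, ‖G (w + x * I) * u x‖ ≤ B := by
    intro w hw x
    rw [norm_mul]
    have := hB (w + x*I) (by rwa [hshift])
    nlinarith [norm_nonneg (u x), hu1 x, norm_nonneg (G (w + x * I))]
  have hdiff : ∀ w : ℂ, |w.re| ≤ y₁ → DifferentiableAt ℂ h w := by
    intro w hw
    set r := (y₂ - y₁)/2 with hr
    have hr0 : 0 < r := by rw [hr, hy2]; linarith
    have hy2' : y₁ + r + r = y₂ := by rw [hr]; ring
    have hy2lt : y₂ < π/2 := by rw [hy2]; linarith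
    have hopen : IsOpen {w : ℂ | |w.re| < π/2} :=
      isOpen_lt (by fun_prop) continuous_const
    have hball : ∀ v ∈ Metric.ball w r, |v.re| ≤ y₁ + r := by
      intro v hv
      have h1 : ‖v - w‖ < r := by simpa [dist_eq_norm] using hv
      have h2 := Complex.abs_re_le_norm (v - w)
      rw [Complex.sub_re] at h2
      have h3 := abs_sub_abs_le_abs_sub v.re w.re
      linarith
    have hda : ∀ v : ℂ, |v.re| ≤ y₂ → DifferentiableAt ℂ G v := by
      intro v hv
      exact hd.differentiableAt (hopen.mem_nhds (by simp only [mem_ofPred_eq]; linarith))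
    have := hasDerivAt_integral_of_dominated_loc_of_deriv_le (μ := μ) (𝕜 := ℂ)
      (F := fun v x => G (v + x * I) * u x) (F' := fun v x => deriv G (v + x * I) * u x)
      (x₀ := w) (s := Metric.ball w r) (bound := fun _ => B / r) (Metric.ball_mem_nhds _ hr0)
      (Filter.Eventually.of_forall fun v => (hmeas v).aestronglyMeasurable)
      (Integrable.of_bound (C := B) (hmeas w).aestronglyMeasurable
        (Filter.Eventually.of_forall fun x => hbd w (by linarith) x))
      (by
        have : Measurable fun x : ℝ => deriv G (w + x * I) :=
          (measurable_deriv G).comp (by fun_prop)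
        exact (this.mul hum).aestronglyMeasurable)
      (Filter.Eventually.of_forall fun x v hv => by
        have h1 : ‖deriv G (v + x * I)‖ ≤ B / r := by
          have hbb : ∀ z ∈ Metric.closedBall (v + x * I) r, |z.re| ≤ y₂ := by
            intro z hz
            have h1 : ‖z - (v + x*I)‖ ≤ r := by simpa [dist_eq_norm] using hz
            have h2 := Complex.abs_re_le_norm (z - (v + x*I))
            rw [Complex.sub_re, hshift] at h2
            have h3 := abs_sub_abs_le_abs_sub z.re v.re
            have := hball v hv
            linarith
          apply Complex.norm_deriv_le_of_forall_mem_sphere_norm_le hr0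
          · apply DifferentiableOn.diffContOnCl
            rw [closure_ball _ hr0.ne']
            exact fun z hz => (hda z (hbb z hz)).differentiableWithinAt
          · exact fun z hz => hB z (hbb z (Metric.sphere_subset_closedBall hz))
        rw [norm_mul]
        nlinarith [norm_nonneg (u x), hu1 x, norm_nonneg (deriv G (v + x * I))])
      (integrable_const _)
      (Filter.Eventually.of_forall fun x v hv => by
        have h1 : HasDerivAt G (deriv G (v + x * I)) (v + x * I) :=
          (hda _ (by rw [hshift]; linarith [hball v hv])).hasDerivAt
        exact (h1.comp_add_const v (x * I)).mul_const (u x))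
    exact this.2.differentiableAt
  have hline : ∀ w : ℂ, auxM G w.re ≠ ⊤ → ‖h w‖ ≤ (auxM G w.re).toReal := by
    intro w hw
    have : ‖h w‖ₑ ≤ auxM G w.re := by
      calc ‖h w‖ₑ ≤ ∫⁻ x, ‖G (w + x * I) * u x‖ₑ ∂μ := enorm_integral_le_lintegral_enorm _
        _ ≤ ∫⁻ x, ‖G (w + x * I)‖ₑ ∂μ := by
          apply lintegral_mono
          intro x
          dsimp only
          rw [enorm_mul]
          have : ‖u x‖ₑ ≤ 1 := by
            rw [← ofReal_norm]; exact ENNReal.ofReal_le_one.2 (hu1 x)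
          exact mul_le_of_le_one_right' this
        _ ≤ ∫⁻ x : ℝ, ‖G (w + x * I)‖ₑ := lintegral_mono' Measure.restrict_le_self le_rfl
        _ = ∫⁻ x : ℝ, ‖G (w.re + (x + w.im : ℝ) * I)‖ₑ := by
          apply lintegral_congr
          intro x
          congr 2
          conv_lhs => rw [← Complex.re_add_im w]
          push_cast; ring
        _ = auxM G w.re := lintegral_add_right_eq_self (fun x : ℝ => ‖G (w.re + x * I)‖ₑ) w.im
    have := ENNReal.toReal_mono hw this
    simpa using this
  have hbdh : ∀ w : ℂ, |w.re| ≤ y₁ → ‖h w‖ ≤ B * μ.real univ := by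
    intro w hw
    exact norm_integral_le_of_norm_le_const (Filter.Eventually.of_forall fun x =>
      hbd w (by rw [hy2]; linarith) x)
  have hclos : closure (HadamardThreeLines.verticalStrip (-y₁) y₁) ⊆ {w : ℂ | |w.re| ≤ y₁} := by
    apply closure_minimal
    · intro w hw
      exact abs_le.2 ⟨hw.1.le, hw.2.le⟩
    · exact isClosed_le (by fun_prop) continuous_const
  have h3 := HadamardThreeLines.norm_le_interp_of_mem_verticalClosedStrip' (f := h) (z := (y₀ : ℂ))
    (a := a) (b := b) (l := -y₁) (u := y₁) (by linarith)
    (by simp only [HadamardThreeLines.verticalClosedStrip, mem_preimage, ofReal_re]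
        exact ⟨hl.le, hr.le⟩)
    (DifferentiableOn.diffContOnCl fun w hw => (hdiff w (hclos hw)).differentiableWithinAt)
    ⟨B * μ.real univ, by
      rintro _ ⟨w, hw, rfl⟩
      exact hbdh w (abs_le.2 hw)⟩
    (by
      intro z hz
      have hz' : z.re = -y₁ := hz
      have := hline z (by rwa [hz'])
      rwa [hz'] at this)
    (by
      intro z hz
      have hz' : z.re = y₁ := hz
      have := hline z (by rwa [hz'])
      rwa [hz'] at this)
  have hs' : ((y₀:ℂ).re - -y₁) / (y₁ - -y₁) = s := by
    rw [hs, ofReal_re]; ring_nf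
  rw [hs'] at h3
  have h4 := Real.geom_mean_le_arith_mean2_weighted (w₁ := 1 - s) (w₂ := s) (p₁ := a) (p₂ := b)
    (by linarith) hs0.le ENNReal.toReal_nonneg ENNReal.toReal_nonneg (by ring)
  have h5 : h y₀ = ((∫ x, ‖G (y₀ + x * I)‖ ∂μ : ℝ) : ℂ) := by
    simp only [hh, hGu]
    exact integral_ofReal
  have hint : Integrable (fun x : ℝ => ‖G (y₀ + x * I)‖) μ := by
    refine Integrable.of_bound (C := B) ?_ ?_
    · exact ((hG.comp (by fun_prop : Measurable fun x : ℝ => (y₀:ℂ) + x * I)).norm).aestronglyMeasurable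
    · refine Filter.Eventually.of_forall fun x => ?_
      rw [norm_norm]
      exact hB _ (by rw [hshift, ofReal_re]; rw [hy2]; linarith)
  have h6 : ∫⁻ x, ‖G (y₀ + x * I)‖ₑ ∂μ = ENNReal.ofReal (∫ x, ‖G (y₀ + x * I)‖ ∂μ) := by
    rw [ofReal_integral_eq_lintegral_ofReal hint (Filter.Eventually.of_forall fun x => norm_nonneg _)]
    simp
  rw [h6]
  apply ENNReal.ofReal_le_ofReal
  rw [h5, Complex.norm_real] at h3
  exact (le_abs_self _).trans (h3.trans h4)

lemma aux_mono (G : ℂ → ℂ) (hG : Measurable G)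
    (hd : DifferentiableOn ℂ G {w | |w.re| < π/2})
    (hb : ∀ y, y < π/2 → ∃ B : ℝ, ∀ w : ℂ, |w.re| ≤ y → ‖G w‖ ≤ B)
    (y₀ y₁ : ℝ) (h0 : 0 < y₀) (h01 : y₀ ≤ y₁) (h1 : y₁ < π/2) :
    auxM G y₀ + auxM G (-y₀) ≤ auxM G y₁ + auxM G (-y₁) := by
  rcases h01.eq_or_lt with rfl | h01
  · exact le_rfl
  have hy1 : 0 < y₁ := h0.trans h01
  set s := (y₀ + y₁)/(2*y₁) with hs
  have e1 := aux_three_lines G hG hd hb y₀ y₁ (by rwa [abs_of_pos h0]) h1 s hs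
  have e2 := aux_three_lines G hG hd hb (-y₀) y₁ (by rwa [abs_neg, abs_of_pos h0]) h1 (1 - s)
    (by rw [hs]; field_simp; ring)
  have hs0 : 0 ≤ s := by rw [hs]; positivity
  have hs1 : s ≤ 1 := by rw [hs, div_le_one (by linarith)]; linarith
  rw [sub_sub_cancel] at e2
  refine (add_le_add e1 e2).trans (le_of_eq ?_)
  have hsum : ENNReal.ofReal (1 - s) + ENNReal.ofReal s = 1 := by
    rw [← ENNReal.ofReal_add (by linarith) hs0]; simp
  calc _ = (ENNReal.ofReal (1 - s) + ENNReal.ofReal s) * auxM G y₁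
        + (ENNReal.ofReal (1 - s) + ENNReal.ofReal s) * auxM G (-y₁) := by ring
    _ = _ := by rw [hsum, one_mul, one_mul]

lemma aux_rearr (p q a b : ℝ≥0∞) (hpq : p ≤ q) (hab : a ≤ b) :
    p * b + q * a ≤ p * a + q * b := by
  obtain ⟨d, rfl⟩ := exists_add_of_le hpq
  obtain ⟨e, rfl⟩ := exists_add_of_le hab
  calc _ = p * a + (p + d) * a + p * e := by ring
    _ ≤ p * a + (p + d) * a + (p * e + d * e) := by gcongr; exact le_self_add
    _ = _ := by ring

lemma aux_chebyshev (s : Set ℝ) (hs : MeasurableSet s) (f g M : ℝ → ℝ≥0∞) (hf : Measurable f)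
    (hg : Measurable g) (hM : Measurable M)
    (hmono : ∀ x ∈ s, ∀ y ∈ s, x ≤ y → M x ≤ M y)
    (hfg : ∀ x ∈ s, ∀ y ∈ s, x ≤ y → f y * g x ≤ f x * g y) :
    (∫⁻ x in s, f x * M x) * (∫⁻ x in s, g x) ≤ (∫⁻ x in s, f x) * (∫⁻ x in s, g x * M x) := by
  have key : ∀ x ∈ s, ∀ y ∈ s,
      f x * M x * g y + f y * M y * g x ≤ f x * (g y * M y) + f y * (g x * M x) := by
    intro x hx y hy
    rcases le_total x y with h | h
    · have := aux_rearr _ _ _ _ (hfg x hx y hy h) (hmono x hx y hy h)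
      calc _ = f y * g x * M y + f x * g y * M x := by ring
        _ ≤ _ := this
        _ = _ := by ring
    · have := aux_rearr _ _ _ _ (hfg y hy x hx h) (hmono y hy x hx h)
      calc _ = f x * g y * M x + f y * g x * M y := by ring
        _ ≤ _ := this
        _ = _ := by ring
  have h2 : ∫⁻ x in s, ∫⁻ y in s, (f x * M x * g y + f y * M y * g x) ≤
      ∫⁻ x in s, ∫⁻ y in s, (f x * (g y * M y) + f y * (g x * M x)) :=
    setLIntegral_mono' hs fun x hx => setLIntegral_mono' hs fun y hy => key x hx y hy
  have e1 : ∫⁻ x in s, ∫⁻ y in s, (f x * M x * g y + f y * M y * g x) =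
      2 * ((∫⁻ x in s, f x * M x) * (∫⁻ x in s, g x)) := by
    have : ∀ x, ∫⁻ y in s, (f x * M x * g y + f y * M y * g x) =
        f x * M x * (∫⁻ y in s, g y) + (∫⁻ y in s, f y * M y) * g x := by
      intro x
      rw [lintegral_add_left (by fun_prop), lintegral_const_mul _ (by fun_prop),
        lintegral_mul_const _ (by fun_prop)]
    simp_rw [this]
    rw [lintegral_add_left (by fun_prop), lintegral_const_mul _ (by fun_prop),
        lintegral_mul_const _ (by fun_prop)]
    ring
  have e2 : ∫⁻ x in s, ∫⁻ y in s, (f x * (g y * M y) + f y * (g x * M x)) =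
      2 * ((∫⁻ x in s, f x) * (∫⁻ x in s, g x * M x)) := by
    have : ∀ x, ∫⁻ y in s, (f x * (g y * M y) + f y * (g x * M x)) =
        f x * (∫⁻ y in s, g y * M y) + (∫⁻ y in s, f y) * (g x * M x) := by
      intro x
      rw [lintegral_add_left (by fun_prop), lintegral_const_mul _ (by fun_prop),
        lintegral_mul_const _ (by fun_prop)]
    simp_rw [this]
    rw [lintegral_add_left (by fun_prop), lintegral_const_mul _ (by fun_prop),
        lintegral_mul_const _ (by fun_prop)]
    ring
  rw [e1, e2] at h2
  exact (ENNReal.mul_le_mul_iff_right (by simp) (by simp)).1 h2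

lemma aux_fold (c : ℝ) (hc : 0 < c) (F : ℝ → ℝ≥0∞) (hF : Measurable F) :
    ∫⁻ t in Ioo (-c) c, F t = ∫⁻ t in Ioo 0 c, (F t + F (-t)) := by
  have h1 : ∫⁻ t in Ioo 0 c, F (-t) = ∫⁻ t in Ioo (-c) 0, F t := by
    have := (Measure.measurePreserving_neg (volume : Measure ℝ)).setLIntegral_comp_preimage
      (measurableSet_Ioo (a := -c) (b := 0)) hF
    rw [← this]
    congr 2
    ext x; simp [and_comm]
  rw [lintegral_add_left hF, h1, ← setLIntegral_congr (Ioo_ae_eq_Ico (a := (0:ℝ)) (b := c)).symm, add_comm,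
    ← lintegral_union measurableSet_Ico]
  · rw [Ioo_union_Ico_eq_Ioo (by linarith) hc.le]
  · rw [Set.disjoint_left]
    intro x hx hx'
    exact absurd hx.2 (not_lt.2 hx'.1)

lemma aux_measM (G : ℂ → ℂ) (hG : Measurable G) : Measurable (auxM G) := by
  have : Measurable (fun p : ℝ × ℝ => ‖G (p.1 + p.2 * I)‖ₑ) :=
    (hG.comp (by fun_prop)).enorm
  exact this.lintegral_prod_right'

lemma aux_fubini (G : ℂ → ℂ) (hG : Measurable G) (g : ℝ → ℝ≥0∞) (hg : Measurable g) :
    ∫⁻ w in {w : ℂ | |w.re| < π/2}, g w.re * ‖G w‖ₑ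
      = ∫⁻ t in Ioo (-(π/2)) (π/2), g t * auxM G t := by
  have h1 := (Complex.volume_preserving_equiv_real_prod.symm).setLIntegral_comp_preimage
    (s := {w : ℂ | |w.re| < π/2}) (measurableSet_lt (by fun_prop) measurable_const)
    (f := fun w => g w.re * ‖G w‖ₑ) (by fun_prop)
  rw [← h1]
  have h2 : Complex.measurableEquivRealProd.symm ⁻¹' {w : ℂ | |w.re| < π/2} =
      Ioo (-(π/2)) (π/2) ×ˢ univ := by
    ext p
    simp [Complex.measurableEquivRealProd_symm_apply, abs_lt]
  rw [h2, Measure.volume_eq_prod, ← Measure.prod_restrict]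
  have hmm : Measurable fun p : ℝ × ℝ => g p.1 * ‖G (p.1 + p.2 * I)‖ₑ :=
    (hg.comp measurable_fst).mul (hG.comp (by fun_prop)).enorm
  have h3 : ∀ p : ℝ × ℝ, g (Complex.measurableEquivRealProd.symm p).re *
      ‖G (Complex.measurableEquivRealProd.symm p)‖ₑ = g p.1 * ‖G (p.1 + p.2 * I)‖ₑ := by
    intro p
    rw [Complex.measurableEquivRealProd_symm_apply, Complex.mk_eq_add_mul_I]
    simp
  simp_rw [h3]
  rw [lintegral_prod _ hmm.aemeasurable]
  apply lintegral_congr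
  intro t
  simp only
  rw [Measure.restrict_univ, lintegral_const_mul]
  · rfl
  · exact (hG.comp (by fun_prop)).enorm

noncomputable def auxW (a t : ℝ) : ℝ≥0∞ := ENNReal.ofReal (Real.cos t ^ a)

lemma aux_measW (a : ℝ) : Measurable (auxW a) := by
  unfold auxW; fun_prop

lemma aux_strip (α β : ℝ) (hβ : α < β) (G : ℂ → ℂ) (hG : Measurable G)
    (hd : DifferentiableOn ℂ G {w | |w.re| < π/2})
    (hfin : ∫⁻ w in {w : ℂ | |w.re| < π/2}, auxW α w.re * ‖G w‖ₑ < ⊤) :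
    (∫⁻ w in {w : ℂ | |w.re| < π/2}, auxW β w.re * ‖G w‖ₑ) * (∫⁻ t in Ioo 0 (π/2), auxW α t)
    ≤ (∫⁻ t in Ioo 0 (π/2), auxW β t) * (∫⁻ w in {w : ℂ | |w.re| < π/2}, auxW α w.re * ‖G w‖ₑ) := by
  have hb := aux_bounded G hG hd (by
    intro y hy
    rcases lt_or_ge y 0 with hy0 | hy0
    · have : {w : ℂ | |w.re| ≤ y} = ∅ := by
        ext w; simp only [mem_ofPred_eq, mem_empty_iff_false, iff_false, not_le]
        exact hy0.trans_le (abs_nonneg _)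
      rw [this]; simp
    have hcy : 0 < Real.cos y := Real.cos_pos_of_mem_Ioo ⟨by linarith, hy⟩
    set k := min 1 (Real.cos y ^ α) with hk
    have hk0 : 0 < k := by rw [hk]; positivity
    have hkW : ∀ w : ℂ, |w.re| ≤ y → ENNReal.ofReal k ≤ auxW α w.re := by
      intro w hw
      apply ENNReal.ofReal_le_ofReal
      have h1 : Real.cos y ≤ Real.cos w.re := by
        rw [← Real.cos_abs w.re]
        exact Real.cos_le_cos_of_nonneg_of_le_pi (abs_nonneg _) (by linarith [Real.pi_pos]) hw
      rcases le_total 0 α with h | h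
      · exact (min_le_right _ _).trans (Real.rpow_le_rpow hcy.le h1 h)
      · exact (min_le_left _ _).trans
          (Real.one_le_rpow_of_pos_of_le_one_of_nonpos (hcy.trans_le h1) (Real.cos_le_one _) h)
    have h2 : ENNReal.ofReal k * ∫⁻ w in {w : ℂ | |w.re| ≤ y}, ‖G w‖ₑ < ⊤ := by
      refine lt_of_le_of_lt ?_ hfin
      rw [← lintegral_const_mul _ (by fun_prop)]
      refine (setLIntegral_mono' (measurableSet_le (by fun_prop) measurable_const)
        (g := fun w => auxW α w.re * ‖G w‖ₑ) fun w hw => ?_).trans (lintegral_mono_set fun w hw => ?_)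
      · have := hkW w hw
        gcongr
      · exact lt_of_le_of_lt hw hy
    by_contra hcon
    rw [not_lt, top_le_iff] at hcon
    rw [hcon, ENNReal.mul_top (by simpa using hk0)] at h2
    exact lt_irrefl _ h2)
  have hfoldG : ∀ a, ∫⁻ w in {w : ℂ | |w.re| < π/2}, auxW a w.re * ‖G w‖ₑ =
      ∫⁻ t in Ioo 0 (π/2), auxW a t * (auxM G t + auxM G (-t)) := by
    intro a
    rw [aux_fubini G hG (auxW a) (aux_measW a), aux_fold (π/2) (by positivity) (fun t => auxW a t * auxM G t)
      ((aux_measW a).mul (aux_measM G hG))]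
    apply lintegral_congr
    intro t
    simp [auxW, mul_add]
  rw [hfoldG, hfoldG]
  have hMm := aux_measM G hG
  apply aux_chebyshev _ measurableSet_Ioo _ _ _ (aux_measW β) (aux_measW α) (by fun_prop)
  · intro x hx y hy hxy
    exact aux_mono G hG hd hb x y hx.1 hxy hy.2
  · intro x hx y hy hxy
    have hcx : 0 < Real.cos x := Real.cos_pos_of_mem_Ioo ⟨by linarith [hx.1, Real.pi_pos], hx.2⟩
    have hcy : 0 < Real.cos y := Real.cos_pos_of_mem_Ioo ⟨by linarith [hy.1, Real.pi_pos], hy.2⟩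
    have hc : Real.cos y ≤ Real.cos x :=
      Real.cos_le_cos_of_nonneg_of_le_pi hx.1.le (by linarith [hy.2, Real.pi_pos]) hxy
    unfold auxW
    rw [← ENNReal.ofReal_mul (by positivity), ← ENNReal.ofReal_mul (by positivity)]
    apply ENNReal.ofReal_le_ofReal
    have e : β = α + (β - α) := by ring
    rw [e, Real.rpow_add hcy, Real.rpow_add hcx]
    have := Real.rpow_le_rpow hcy.le hc (sub_pos.2 hβ).le
    have hp : 0 < Real.cos y ^ α * Real.cos x ^ α := by positivity
    nlinarith

lemma aux_const (a : ℝ) (ha : -1 < a) :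
    ∫⁻ t in Ioo 0 (π/2), auxW a t = ENNReal.ofReal
      (π * 2 ^ (-a - 1) * Real.Gamma (a + 1) / Real.Gamma (1 + a/2) ^ 2) := by
  have h0 : 0 < (a+1)/2 := by linarith
  have himg : (fun t : ℝ => (1 + Real.sin t)/2) '' Ioo (-(π/2)) (π/2) = Ioo 0 1 := by
    ext x
    constructor
    · rintro ⟨t, ht, rfl⟩
      have h1 : Real.sin (-(π/2)) < Real.sin t :=
        Real.strictMonoOn_sin ⟨le_rfl, by linarith [Real.pi_pos]⟩ ⟨ht.1.le, ht.2.le⟩ ht.1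
      have h2 : Real.sin t < Real.sin (π/2) :=
        Real.strictMonoOn_sin ⟨ht.1.le, ht.2.le⟩ ⟨by linarith [Real.pi_pos], le_rfl⟩ ht.2
      rw [Real.sin_neg, Real.sin_pi_div_two] at h1
      rw [Real.sin_pi_div_two] at h2
      constructor <;> simp only <;> linarith
    · rintro ⟨hx0, hx1⟩
      refine ⟨Real.arcsin (2*x-1), ⟨?_, ?_⟩, ?_⟩
      · exact Real.neg_pi_div_two_lt_arcsin.2 (by linarith)
      · exact Real.arcsin_lt_pi_div_two.2 (by linarith)
      · simp only
        rw [Real.sin_arcsin (by linarith) (by linarith)]; ring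
  have hcv := lintegral_image_eq_lintegral_abs_deriv_mul (s := Ioo (-(π/2)) (π/2))
    (f := fun t : ℝ => (1 + Real.sin t)/2) (f' := fun t => Real.cos t / 2) measurableSet_Ioo
    (fun x _ => (((Real.hasDerivAt_sin x).const_add 1).div_const 2).hasDerivWithinAt)
    (by
      intro x hx y hy hxy
      simp only at hxy
      exact Real.injOn_sin ⟨hx.1.le, hx.2.le⟩ ⟨hy.1.le, hy.2.le⟩ (by linarith))
    (fun x => ENNReal.ofReal (1 / ProbabilityTheory.beta ((a+1)/2) ((a+1)/2) * x ^ ((a+1)/2 - 1) *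
      (1 - x) ^ ((a+1)/2 - 1)))
  rw [himg, ← ProbabilityTheory.lintegral_betaPDF,
    ProbabilityTheory.lintegral_betaPDF_eq_one h0 h0] at hcv
  set Bt := ProbabilityTheory.beta ((a+1)/2) ((a+1)/2) with hBt
  have hBt0 : 0 < Bt := ProbabilityTheory.beta_pos h0 h0
  have hpt : ∀ t ∈ Ioo (-(π/2)) (π/2), ENNReal.ofReal |Real.cos t / 2| *
      ENNReal.ofReal (1 / Bt * ((1 + Real.sin t)/2) ^ ((a+1)/2 - 1) *
      (1 - (1 + Real.sin t)/2) ^ ((a+1)/2 - 1)) = ENNReal.ofReal (1 / Bt * 2 ^ (-a)) * auxW a t := by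
    intro t ht
    have hc : 0 < Real.cos t := Real.cos_pos_of_mem_Ioo ht
    have hmem : (1 + Real.sin t)/2 ∈ Ioo (0:ℝ) 1 := by rw [← himg]; exact ⟨t, ht, rfl⟩
    unfold auxW
    rw [← ENNReal.ofReal_mul (abs_nonneg _), ← ENNReal.ofReal_mul (by positivity)]
    congr 1
    rw [abs_of_pos (by positivity), mul_assoc (1/Bt), ← Real.mul_rpow hmem.1.le (by linarith [hmem.2])]
    have : (1 + Real.sin t)/2 * (1 - (1 + Real.sin t)/2) = (Real.cos t / 2) ^ (2:ℝ) := by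
      rw [Real.rpow_two, div_pow, Real.cos_sq']; ring
    rw [this, ← Real.rpow_mul (by positivity)]
    have h3 : Real.cos t / 2 * (Real.cos t / 2) ^ (2 * ((a+1)/2 - 1)) = (Real.cos t / 2) ^ a := by
      nth_rewrite 1 [← Real.rpow_one (Real.cos t / 2)]
      rw [← Real.rpow_add (by positivity)]
      congr 1; ring
    rw [mul_left_comm, h3, Real.div_rpow hc.le (by norm_num), Real.rpow_neg (by norm_num)]
    field_simp
  rw [setLIntegral_congr_fun measurableSet_Ioo hpt, lintegral_const_mul _ (aux_measW a),
    aux_fold _ (by positivity) _ (aux_measW a)] at hcv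
  have hsym : ∀ t, auxW a t + auxW a (-t) = 2 * auxW a t := by
    intro t; simp [auxW, two_mul]
  simp_rw [hsym] at hcv
  rw [lintegral_const_mul _ (aux_measW a), ← mul_assoc] at hcv
  rw [mul_comm] at hcv
  have hK := ENNReal.eq_inv_of_mul_eq_one_left hcv.symm
  have h2 : (2:ℝ≥0∞) = ENNReal.ofReal 2 := by simp
  rw [hK, h2, ← ENNReal.ofReal_mul (by positivity), ← ENNReal.ofReal_inv_of_pos (by positivity)]
  congr 1
  have hdup := Real.Gamma_mul_Gamma_add_half ((a+1)/2)
  have e1 : (a+1)/2 + 1/2 = 1 + a/2 := by ring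
  have e2 : 2 * ((a+1)/2) = a + 1 := by ring
  have e3 : 1 - (a + 1) = -a := by ring
  rw [e1, e2, e3] at hdup
  have e4 : (a+1)/2 + (a+1)/2 = a + 1 := by ring
  have hg1 : 0 < Real.Gamma ((a+1)/2) := Real.Gamma_pos_of_pos h0
  have hg2 : 0 < Real.Gamma (1 + a/2) := Real.Gamma_pos_of_pos (by linarith)
  have hg3 : 0 < Real.Gamma (a+1) := Real.Gamma_pos_of_pos (by linarith)
  have hga : Real.Gamma ((a+1)/2) = Real.Gamma (a+1) * 2 ^ (-a) * √π / Real.Gamma (1 + a/2) := by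
    rw [← hdup, mul_div_cancel_right₀ _ hg2.ne']
  rw [hBt, ProbabilityTheory.beta, e4, hga, Real.rpow_sub (by norm_num), Real.rpow_one]
  have hp : 0 < (2:ℝ) ^ (-a) := by positivity
  have hsq : √π ^ 2 = π := Real.sq_sqrt Real.pi_pos.le
  field_simp
  rw [hsq]

noncomputable def auxZ (w : ℂ) : ℂ := (Complex.exp (I * w) - 1) / (Complex.exp (I * w) + 1)

lemma aux_exp_re (w : ℂ) : (Complex.exp (I * w)).re = ‖Complex.exp (I * w)‖ * Real.cos w.re := by
  rw [Complex.exp_re, Complex.norm_exp]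
  simp

lemma aux_exp_pos (w : ℂ) (hw : |w.re| < π/2) : 0 < (Complex.exp (I * w)).re := by
  rw [aux_exp_re]
  have : 0 < Real.cos w.re := Real.cos_pos_of_mem_Ioo (abs_lt.1 hw)
  have := norm_pos_iff.2 (Complex.exp_ne_zero (I * w))
  positivity

lemma aux_ne (E : ℂ) (hE : 0 < E.re) : E + 1 ≠ 0 := by
  intro h
  have := congrArg Complex.re h
  simp at this
  linarith

lemma aux_Z_sq (w : ℂ) (hw : |w.re| < π/2) :
    1 - auxZ w ^ 2 = 4 * Complex.exp (I * w) / (Complex.exp (I * w) + 1) ^ 2 := by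
  have := aux_ne _ (aux_exp_pos w hw)
  unfold auxZ
  field_simp
  ring

lemma aux_Z_norm (w : ℂ) (hw : |w.re| < π/2) :
    1 - ‖auxZ w‖ ^ 2 = ‖1 - auxZ w ^ 2‖ * Real.cos w.re := by
  have hne := aux_ne _ (aux_exp_pos w hw)
  rw [aux_Z_sq w hw]
  have hre := aux_exp_re w
  unfold auxZ
  set E := Complex.exp (I * w)
  have hn : 0 < ‖E + 1‖ := norm_pos_iff.2 hne
  rw [norm_div, norm_div, norm_mul, norm_pow]
  have h1 : ‖E + 1‖ ^ 2 - ‖E - 1‖ ^ 2 = 4 * (‖E‖ * Real.cos w.re) := by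
    rw [← hre, ← Complex.normSq_eq_norm_sq, ← Complex.normSq_eq_norm_sq, Complex.normSq_apply,
      Complex.normSq_apply]
    simp
    ring
  have h4 : ‖(4:ℂ)‖ = 4 := by simp
  rw [h4]
  field_simp
  linarith

lemma aux_Z_deriv (w : ℂ) (hw : |w.re| < π/2) :
    HasDerivAt auxZ (I * (1 - auxZ w ^ 2) / 2) w := by
  have hne := aux_ne _ (aux_exp_pos w hw)
  have h1 : HasDerivAt (fun w : ℂ => Complex.exp (I * w)) (Complex.exp (I * w) * (I * 1)) w :=
    ((hasDerivAt_id w).const_mul I).cexp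
  have h2 := (h1.sub_const 1).div (h1.add_const 1) hne
  have h3 : I * (1 - auxZ w ^ 2) / 2 = (Complex.exp (I * w) * (I * 1) * (Complex.exp (I * w) + 1)
      - (Complex.exp (I * w) - 1) * (Complex.exp (I * w) * (I * 1))) /
      (Complex.exp (I * w) + 1) ^ 2 := by
    rw [aux_Z_sq w hw]
    field_simp
    ring
  rw [h3]
  exact h2

lemma aux_Z_inj : InjOn auxZ {w | |w.re| < π/2} := by
  intro w hw v hv h
  have h1 := aux_ne _ (aux_exp_pos w hw)
  have h2 := aux_ne _ (aux_exp_pos v hv)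
  unfold auxZ at h
  rw [div_eq_div_iff h1 h2] at h
  have h3 : Complex.exp (I * w) = Complex.exp (I * v) := by linear_combination h / 2
  have hw' := abs_lt.1 (show |w.re| < π/2 from hw)
  have hv' := abs_lt.1 (show |v.re| < π/2 from hv)
  have h4 := Complex.exp_inj_of_neg_pi_lt_of_le_pi (x := I * w) (y := I * v)
    (by simp; linarith [hw'.1, Real.pi_pos]) (by simp; linarith [hw'.2, Real.pi_pos])
    (by simp; linarith [hv'.1, Real.pi_pos]) (by simp; linarith [hv'.2, Real.pi_pos]) h3
  exact mul_left_cancel₀ I_ne_zero h4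

lemma aux_Z_mem (w : ℂ) (hw : |w.re| < π/2) : auxZ w ∈ Metric.ball (0:ℂ) 1 := by
  have h := aux_Z_norm w hw
  have hc : 0 < Real.cos w.re := Real.cos_pos_of_mem_Ioo (abs_lt.1 hw)
  have hn : 0 < ‖1 - auxZ w ^ 2‖ := by
    rw [aux_Z_sq w hw]
    have := aux_ne _ (aux_exp_pos w hw)
    simp [this, Complex.exp_ne_zero]
  have : 0 < 1 - ‖auxZ w‖ ^ 2 := by rw [h]; positivity
  simp only [Metric.mem_ball, dist_zero_right]
  nlinarith [norm_nonneg (auxZ w)]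

lemma aux_Z_image : auxZ '' {w | |w.re| < π/2} = Metric.ball (0:ℂ) 1 := by
  ext z
  constructor
  · rintro ⟨w, hw, rfl⟩
    exact aux_Z_mem w hw
  · intro hz
    have hz1 : ‖z‖ < 1 := by simpa using hz
    have hz0 : 1 - z ≠ 0 := by
      intro h
      have : z = 1 := by linear_combination -h
      rw [this] at hz1; simp at hz1
    have hre : 0 < ((1 + z)/(1 - z)).re := by
      have hns : 0 < Complex.normSq (1 - z) := Complex.normSq_pos.2 hz0
      rw [Complex.div_re]
      have : ‖z‖ ^ 2 = z.re * z.re + z.im * z.im := by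
        rw [← Complex.normSq_eq_norm_sq, Complex.normSq_apply]
      rw [← add_div]
      apply div_pos _ hns
      simp
      nlinarith [norm_nonneg z]
    have hE0 : (1 + z)/(1 - z) ≠ 0 := by
      intro h; rw [h] at hre; simp at hre
    refine ⟨-I * Complex.log ((1 + z)/(1 - z)), ?_, ?_⟩
    · have := Complex.abs_arg_lt_pi_div_two_iff.2 (Or.inl hre)
      simpa [Complex.log_im] using this
    · unfold auxZ
      have : I * (-I * Complex.log ((1 + z)/(1 - z))) = Complex.log ((1 + z)/(1 - z)) := by
        linear_combination (-Complex.log ((1 + z)/(1 - z))) * I_mul_I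
      rw [this, Complex.exp_log hE0]
      have h2 : (1 + z)/(1 - z) + 1 ≠ 0 := aux_ne _ hre
      rw [div_eq_iff h2]
      field_simp
      ring

lemma aux_det (d : ℂ) :
    ((ContinuousLinearMap.toSpanSingleton ℂ d).restrictScalars ℝ : ℂ →L[ℝ] ℂ).det = ‖d‖ ^ 2 := by
  rw [← Complex.normSq_eq_norm_sq]
  simp [ContinuousLinearMap.det, LinearMap.det_restrictScalars, Algebra.norm_complex_eq]

lemma aux_change (g : ℂ → ℝ≥0∞) :
    ∫⁻ z in Metric.ball (0:ℂ) 1, g z =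
      ∫⁻ w in {w : ℂ | |w.re| < π/2}, ENNReal.ofReal (‖1 - auxZ w ^ 2‖ ^ 2 / 4) * g (auxZ w) := by
  have hmeas : MeasurableSet {w : ℂ | |w.re| < π/2} :=
    measurableSet_lt (by fun_prop) measurable_const
  have := lintegral_image_eq_lintegral_abs_det_fderiv_mul volume hmeas
    (f' := fun w => (ContinuousLinearMap.toSpanSingleton ℂ (I * (1 - auxZ w ^ 2) / 2)).restrictScalars ℝ)
    (fun w hw => ((aux_Z_deriv w hw).hasFDerivAt.restrictScalars ℝ).hasFDerivWithinAt)
    aux_Z_inj g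
  rw [aux_Z_image] at this
  rw [this]
  apply lintegral_congr
  intro w
  rw [aux_det, abs_of_nonneg (by positivity)]
  congr 2
  rw [norm_div, norm_mul, Complex.norm_I, one_mul, div_pow]
  norm_num

lemma aux_weight (α c : ℝ) (φ : ℂ → ℂ) (w : ℂ) (hw : |w.re| < π/2) :
    ENNReal.ofReal (‖1 - auxZ w ^ 2‖ ^ 2 / 4) * ENNReal.ofReal
      ((1 - ‖auxZ w‖ ^ 2) ^ c * ‖1 - auxZ w ^ 2‖ ^ (-(c - α)) * ‖φ (auxZ w)‖ ^ 2) =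
    auxW c w.re * ‖1/4 * φ (auxZ w) ^ 2 * (1 - auxZ w ^ 2) ^ ((α + 2 : ℝ) : ℂ)‖ₑ := by
  have hc : 0 < Real.cos w.re := Real.cos_pos_of_mem_Ioo (abs_lt.1 hw)
  have hn : 0 < ‖1 - auxZ w ^ 2‖ := by
    rw [aux_Z_sq w hw]
    have := aux_ne _ (aux_exp_pos w hw)
    simp [this, Complex.exp_ne_zero]
  rw [← ofReal_norm, auxW, ← ENNReal.ofReal_mul (by positivity), ← ENNReal.ofReal_mul (by positivity)]
  congr 1
  rw [aux_Z_norm w hw, norm_mul, norm_mul, norm_pow, Complex.norm_cpow_real]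
  set N := ‖1 - auxZ w ^ 2‖
  rw [Real.mul_rpow hn.le hc.le]
  have h1 : N ^ (α + 2) = N ^ 2 * N ^ c * N ^ (-(c - α)) := by
    rw [← Real.rpow_two, ← Real.rpow_add hn, ← Real.rpow_add hn]
    congr 1; ring
  rw [h1]
  have : ‖(1/4 : ℂ)‖ = 1/4 := by simp
  rw [this]
  ring

lemma aux_main (α β : ℝ) (hα : -1 < α) (hβ : α < β) (φ : ℂ → ℂ)
    (hφ : DifferentiableOn ℂ φ (Metric.ball (0 : ℂ) 1))
    (hfin : ∫⁻ z in Metric.ball (0:ℂ) 1, ENNReal.ofReal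
      ((1 - ‖z‖ ^ 2) ^ α * ‖1 - z ^ 2‖ ^ (-(α - α)) * ‖φ z‖ ^ 2) < ⊤) :
    (∫⁻ z in Metric.ball (0:ℂ) 1, ENNReal.ofReal
      ((1 - ‖z‖ ^ 2) ^ β * ‖1 - z ^ 2‖ ^ (-(β - α)) * ‖φ z‖ ^ 2)) *
        (∫⁻ t in Ioo 0 (π/2), auxW α t)
    ≤ (∫⁻ t in Ioo 0 (π/2), auxW β t) * ∫⁻ z in Metric.ball (0:ℂ) 1, ENNReal.ofReal
      ((1 - ‖z‖ ^ 2) ^ α * ‖1 - z ^ 2‖ ^ (-(α - α)) * ‖φ z‖ ^ 2) := by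
  set S := {w : ℂ | |w.re| < π/2} with hS
  have hopen : IsOpen S := isOpen_lt (by fun_prop) continuous_const
  have hmeas : MeasurableSet S := hopen.measurableSet
  set Ψ : ℂ → ℂ := fun w => 1/4 * φ (auxZ w) ^ 2 * (1 - auxZ w ^ 2) ^ ((α + 2 : ℝ) : ℂ) with hΨ
  have hΨd : DifferentiableOn ℂ Ψ S := by
    intro w hw
    apply DifferentiableAt.differentiableWithinAt
    have hz := (aux_Z_deriv w hw).differentiableAt
    have hzm := aux_Z_mem w hw
    have hφ' : DifferentiableAt ℂ φ (auxZ w) :=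
      hφ.differentiableAt (Metric.isOpen_ball.mem_nhds hzm)
    have hcomp : DifferentiableAt ℂ (fun w => φ (auxZ w)) w := hφ'.comp w hz
    refine ((hcomp.pow 2).const_mul (1/4)).mul (((hz.pow 2).const_sub 1).cpow_const ?_)
    left
    have h1 : ‖auxZ w‖ < 1 := by simpa using hzm
    have h2 := Complex.re_le_norm (auxZ w ^ 2)
    rw [norm_pow] at h2
    simp only [Complex.sub_re, Complex.one_re, Pi.pow_apply]
    nlinarith [norm_nonneg (auxZ w)]
  set G := S.indicator Ψ with hG
  have hGm : Measurable G := by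
    classical
    rw [hG, ← piecewise_eq_indicator]
    exact hΨd.continuousOn.measurable_piecewise continuousOn_const hmeas
  have hGd : DifferentiableOn ℂ G S := hΨd.congr fun w hw => indicator_of_mem hw _
  have hI : ∀ c, ∫⁻ z in Metric.ball (0:ℂ) 1, ENNReal.ofReal
      ((1 - ‖z‖ ^ 2) ^ c * ‖1 - z ^ 2‖ ^ (-(c - α)) * ‖φ z‖ ^ 2) =
      ∫⁻ w in S, auxW c w.re * ‖G w‖ₑ := by
    intro c
    rw [aux_change]
    apply setLIntegral_congr_fun hmeas
    intro w hw
    simp only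
    rw [aux_weight α c φ w hw, hG, indicator_of_mem hw]
  rw [hI] at hfin
  rw [hI, hI]
  exact aux_strip α β hβ G hGm hGd hfin

theorem sharp_multiplier_inequality (α β : ℝ) (hα : -1 < α) (hβ : α < β) (φ : ℂ → ℂ)
    (hφ : DifferentiableOn ℂ φ (Metric.ball (0 : ℂ) 1))
    (hint : IntegrableOn (fun z : ℂ => ‖φ z‖ ^ 2 * (1 - ‖z‖ ^ 2) ^ α) (Metric.ball (0 : ℂ) 1)) :
    (β + 1) / π *
        ∫ z in Metric.ball (0 : ℂ) 1,
          (1 - ‖z‖ ^ 2) ^ β * ‖1 - z ^ 2‖ ^ (-(β - α)) * ‖φ z‖ ^ 2 ≤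
      2 ^ (α - β) * (Real.Gamma (β + 2) / Real.Gamma (α + 2)) *
          (Real.Gamma (1 + α / 2) / Real.Gamma (1 + β / 2)) ^ 2 *
        ((α + 1) / π *
          ∫ z in Metric.ball (0 : ℂ) 1, ‖φ z‖ ^ 2 * (1 - ‖z‖ ^ 2) ^ α) := by
  have hpos : ∀ z ∈ Metric.ball (0:ℂ) 1, 0 < 1 - ‖z‖ ^ 2 := by
    intro z hz
    have h1 : ‖z‖ < 1 := by simpa using hz
    nlinarith [norm_nonneg z]
  have hR : ∀ z : ℂ, (1 - ‖z‖ ^ 2) ^ α * ‖1 - z ^ 2‖ ^ (-(α - α)) * ‖φ z‖ ^ 2 =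
      ‖φ z‖ ^ 2 * (1 - ‖z‖ ^ 2) ^ α := by
    intro z; simp [mul_comm]
  have hRnn : ∀ᵐ z ∂(volume.restrict (Metric.ball (0:ℂ) 1)),
      0 ≤ ‖φ z‖ ^ 2 * (1 - ‖z‖ ^ 2) ^ α :=
    ae_restrict_of_forall_mem measurableSet_ball fun z hz => by
      have := hpos z hz
      positivity
  have hLnn : ∀ᵐ z ∂(volume.restrict (Metric.ball (0:ℂ) 1)),
      0 ≤ (1 - ‖z‖ ^ 2) ^ β * ‖1 - z ^ 2‖ ^ (-(β - α)) * ‖φ z‖ ^ 2 :=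
    ae_restrict_of_forall_mem measurableSet_ball fun z hz => by
      have := hpos z hz
      positivity
  have hLm : AEStronglyMeasurable (fun z : ℂ =>
      (1 - ‖z‖ ^ 2) ^ β * ‖1 - z ^ 2‖ ^ (-(β - α)) * ‖φ z‖ ^ 2)
      (volume.restrict (Metric.ball (0:ℂ) 1)) := by
    have h1 : AEStronglyMeasurable (fun z : ℂ => ‖φ z‖ ^ 2) (volume.restrict (Metric.ball (0:ℂ) 1)) :=
      (hφ.continuousOn.norm.pow 2).aestronglyMeasurable measurableSet_ball
    have h2 : Measurable (fun z : ℂ => (1 - ‖z‖ ^ 2) ^ β * ‖1 - z ^ 2‖ ^ (-(β - α))) := by fun_prop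
    exact h2.aestronglyMeasurable.mul h1
  have hRfin : ∫⁻ z in Metric.ball (0:ℂ) 1, ENNReal.ofReal (‖φ z‖ ^ 2 * (1 - ‖z‖ ^ 2) ^ α) < ⊤ :=
    (lintegral_ofReal_ne_top_iff_integrable hint.1 hRnn).2 hint |>.lt_top
  have hmain := aux_main α β hα hβ φ hφ (by simp_rw [hR]; exact hRfin)
  simp_rw [hR] at hmain
  rw [aux_const α hα, aux_const β (hα.trans hβ)] at hmain
  rw [integral_eq_lintegral_of_nonneg_ae hLnn hLm, integral_eq_lintegral_of_nonneg_ae hRnn hint.1]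
  set L := ∫⁻ z in Metric.ball (0:ℂ) 1, ENNReal.ofReal
      ((1 - ‖z‖ ^ 2) ^ β * ‖1 - z ^ 2‖ ^ (-(β - α)) * ‖φ z‖ ^ 2)
  set R := ∫⁻ z in Metric.ball (0:ℂ) 1, ENNReal.ofReal (‖φ z‖ ^ 2 * (1 - ‖z‖ ^ 2) ^ α)
  have ga1 : 0 < Real.Gamma (α + 1) := Real.Gamma_pos_of_pos (by linarith)
  have gb1 : 0 < Real.Gamma (β + 1) := Real.Gamma_pos_of_pos (by linarith)
  have ga2 : 0 < Real.Gamma (1 + α/2) := Real.Gamma_pos_of_pos (by linarith)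
  have gb2 : 0 < Real.Gamma (1 + β/2) := Real.Gamma_pos_of_pos (by linarith)
  have hreal := ENNReal.toReal_mono (ENNReal.mul_ne_top ENNReal.ofReal_ne_top hRfin.ne) hmain
  rw [ENNReal.toReal_mul, ENNReal.toReal_mul, ENNReal.toReal_ofReal (by positivity),
    ENNReal.toReal_ofReal (by positivity)] at hreal
  have eα : Real.Gamma (α + 2) = (α + 1) * Real.Gamma (α + 1) := by
    rw [← Real.Gamma_add_one (by linarith)]; ring_nf
  have eβ : Real.Gamma (β + 2) = (β + 1) * Real.Gamma (β + 1) := by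
    rw [← Real.Gamma_add_one (by linarith)]; ring_nf
  have ha1 : 0 < α + 1 := by linarith
  have hb1 : 0 < β + 1 := by linarith
  rw [eα, eβ]
  have pα : (2:ℝ) ^ (-α - 1) = (2 ^ α)⁻¹ / 2 := by
    rw [Real.rpow_sub (by norm_num), Real.rpow_neg (by norm_num), Real.rpow_one]
  have pβ : (2:ℝ) ^ (-β - 1) = (2 ^ β)⁻¹ / 2 := by
    rw [Real.rpow_sub (by norm_num), Real.rpow_neg (by norm_num), Real.rpow_one]
  rw [Real.rpow_sub (by norm_num)]
  rw [pα, pβ] at hreal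
  have q1 : 0 < (2:ℝ) ^ α := by positivity
  have q2 : 0 < (2:ℝ) ^ β := by positivity
  set x := L.toReal
  set y := R.toReal
  set cα := π * ((2 ^ α)⁻¹ / 2) * Real.Gamma (α + 1) / Real.Gamma (1 + α / 2) ^ 2 with hcα
  have hcα0 : 0 < cα := by positivity
  have hx : x ≤ π * ((2 ^ β)⁻¹ / 2) * Real.Gamma (β + 1) / Real.Gamma (1 + β / 2) ^ 2 * y / cα :=
    (le_div_iff₀ hcα0).2 hreal
  calc (β + 1) / π * x ≤ (β + 1) / π *
        (π * ((2 ^ β)⁻¹ / 2) * Real.Gamma (β + 1) / Real.Gamma (1 + β / 2) ^ 2 * y / cα) := by gcongr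
    _ = _ := by
      rw [hcα]
      field_simp
end
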